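/- arXiv:1907.12963 — 4 statements merged into one kernel-verified Lean document; each statement's English description precedes it below -/
import Mathlib

section
/- For every integer p ≥ 4, the energy of the line graph of K_{p+2}^{(p)} equals the energy of the complement of the line graph of K_{p+2}^{(p)}; that is, E(L(K_{p+2}^{(p)})) = E(complement of L(K_{p+2}^{(p)})). -/
open Polynomial

/-- Adjacency matrix over ℝ, using classical instances. -/
noncomputable def adjMat {V : Type*} [Finite V] (G : SimpleGraph V) : Matrix V V ℝ :=
  letI := Fintype.ofFinite V
  letI := Classical.decEq V
  letI := Classical.decRel G.Adj
  G.adjMatrix ℝ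

/-- The energy of a graph: the sum of the absolute values of the eigenvalues of its
adjacency matrix (equivalently, of the roots of its characteristic polynomial, with
multiplicity, which all are real since the matrix is real symmetric). -/
noncomputable def energy {V : Type*} [Finite V] (G : SimpleGraph V) : ℝ :=
  letI := Fintype.ofFinite V
  letI := Classical.decEq V
  (((adjMat G).charpoly).roots.map (fun x => |x|)).sum

/-- `K_{p+2}^{(p)}`: the graph on `2p+1` vertices obtained from complete graphs `K_{p+2}`
(on the vertices `0,…,p+1`) and `K_p` (on the vertices `p+1,…,2p`) by identifying
the vertex `p+1`. -/
def KpPlusTwoP (p : ℕ) : SimpleGraph (Fin (2 * p + 1)) :=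
  SimpleGraph.fromRel (fun i j =>
    ((i : ℕ) ≤ p + 1 ∧ (j : ℕ) ≤ p + 1) ∨ (p + 1 ≤ (i : ℕ) ∧ p + 1 ≤ (j : ℕ)))

open Matrix
open scoped Finset

theorem adjMat_eq_adjMatrix {V : Type*} [Fintype V] [DecidableEq V] (G : SimpleGraph V)
    [DecidableRel G.Adj] : adjMat G = G.adjMatrix ℝ := by
  ext i j
  simp [adjMat, SimpleGraph.adjMatrix_apply]

theorem energy_eq_sum_abs_of_charpoly_eq {V : Type*} [Fintype V] [DecidableEq V]
    (G : SimpleGraph V) [DecidableRel G.Adj] (s : Multiset ℝ)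
    (h : (G.adjMatrix ℝ).charpoly = (s.map fun a => X - C a).prod) :
    energy G = (s.map fun a => |a|).sum := by
  have h' : @Matrix.charpoly ℝ _ V (Classical.decEq V) (Fintype.ofFinite V) (adjMat G) =
      (s.map fun a => X - C a).prod := by
    rw [adjMat_eq_adjMatrix, ← h]
    congr!
  rw [energy, h', roots_multiset_prod_X_sub_C]

/-- Matrix determinant lemma for a matrix that is, up to its diagonal, constant on the blocks
cut out by the fibres of `f`. -/
theorem det_diagonal_add_submatrix_mul_prod {V ι R : Type*} [Fintype V] [DecidableEq V] [Fintype ι]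
    [DecidableEq ι] [Field R] (f : V → ι) (d : ι → R) (K : Matrix ι ι R) (hd : ∀ c, d c ≠ 0) :
    (diagonal (d ∘ f) + K.submatrix f f).det * ∏ c, d c =
      (∏ v, d (f v)) * (diagonal d + K * diagonal fun c => (#{v | f v = c} : R)).det := by
  let U : Matrix V ι R := (1 : Matrix ι ι R).submatrix f id
  have hK : K.submatrix f f = U * (K * Uᵀ) := by
    ext i j
    simp [U, Matrix.mul_apply, Matrix.one_apply]
  have hunit : IsUnit (diagonal (d ∘ f)).det := by
    simp [isUnit_iff_ne_zero, det_diagonal, Finset.prod_ne_zero_iff, hd]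
  have hinv : (diagonal (d ∘ f))⁻¹ = diagonal fun v => (d (f v))⁻¹ := by
    refine inv_eq_left_inv ?_
    simp [hd]
  have hU : Uᵀ * (diagonal fun v => (d (f v))⁻¹) * U * diagonal d =
      diagonal fun c => (#{v | f v = c} : R) := by
    ext a b
    rw [Matrix.mul_diagonal, Matrix.mul_apply]
    simp only [Matrix.mul_diagonal, U, Matrix.one_apply, transpose_apply, submatrix_apply, id,
      diagonal_apply]
    rw [Finset.sum_mul, Finset.card_filter, Nat.cast_sum]
    split_ifs with hab
    · subst hab
      refine Finset.sum_congr rfl fun v _ => ?_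
      by_cases h : f v = a <;> simp [h, hd]
    · refine Finset.sum_eq_zero fun v _ => ?_
      by_cases h : f v = a <;> simp [h, hab]
  rw [hK, det_add_mul _ _ hunit, hinv, det_diagonal, mul_assoc, ← det_diagonal (d := d), ← det_mul,
    ← hU]
  congr 2
  simp only [Matrix.add_mul, Matrix.one_mul, Matrix.mul_assoc]

theorem charpoly_diagonal_add_submatrix_mul_prod {V ι R : Type*} [Fintype V] [DecidableEq V]
    [Fintype ι] [DecidableEq ι] [Field R] [Infinite R] (f : V → ι) (d : ι → R)
    (K : Matrix ι ι R) :
    (diagonal (d ∘ f) + K.submatrix f f).charpoly * ∏ c, (X - C (d c)) =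
      (∏ v, (X - C (d (f v)))) *
        (diagonal d + K * diagonal fun c => (#{v | f v = c} : R)).charpoly := by
  refine eq_of_infinite_eval_eq _ _ ((Set.finite_range d).infinite_compl.mono fun t ht => ?_)
  have h := det_diagonal_add_submatrix_mul_prod f (fun c => t - d c) (-K)
    fun c hc => ht ⟨c, (sub_eq_zero.mp hc).symm⟩
  simp only [Set.mem_ofPred_eq, eval_mul, eval_prod, eval_sub, eval_X, eval_C, eval_charpoly]
  convert h using 3
  · ext i j
    by_cases hij : i = j <;> simp [hij]
    ring
  · ext i j
    by_cases hij : i = j <;> simp [hij]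
    ring

namespace SimpleGraph

variable {V : Type*} [Fintype V] [DecidableEq V] (G : SimpleGraph V) [DecidableRel G.Adj]

/-- The vertex-edge incidence matrix with columns indexed by the edges only. -/
noncomputable def edgeIncMatrix : Matrix V G.edgeSet ℝ :=
  (G.incMatrix ℝ).submatrix id (↑)

omit [Fintype V] in
theorem edgeIncMatrix_apply (v : V) (e : G.edgeSet) :
    G.edgeIncMatrix v e = if v ∈ (e : Sym2 V) then 1 else 0 := by
  simp [edgeIncMatrix, incMatrix_apply', incidenceSet]

theorem edgeIncMatrix_mul_transpose :
    G.edgeIncMatrix * G.edgeIncMatrixᵀ =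
      diagonal (fun v => (G.degree v : ℝ)) + G.adjMatrix ℝ := by
  have h : G.edgeIncMatrix * G.edgeIncMatrixᵀ = G.incMatrix ℝ * (G.incMatrix ℝ)ᵀ := by
    ext i j
    simp only [Matrix.mul_apply, transpose_apply, edgeIncMatrix, submatrix_apply, id]
    refine Fintype.sum_of_injective _ Subtype.val_injective _ _ (fun e he => ?_) fun _ => rfl
    rw [incMatrix_of_notMem_incidenceSet, zero_mul]
    exact fun h => he (by simpa using h.1)
  rw [h, incMatrix_mul_transpose]
  ext i j
  by_cases hij : i = j <;> simp [hij, adjMatrix_apply]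

theorem edgeIncMatrix_transpose_mul [DecidableRel G.lineGraph.Adj] :
    G.edgeIncMatrixᵀ * G.edgeIncMatrix = G.lineGraph.adjMatrix ℝ + scalar _ 2 := by
  ext e e'
  by_cases hee : e = e'
  · subst hee
    simpa [edgeIncMatrix, Matrix.mul_apply] using G.incMatrix_transpose_mul_diag (R := ℝ) (e := e)
  · simp only [Matrix.mul_apply, transpose_apply, edgeIncMatrix_apply, Matrix.add_apply,
      adjMatrix_apply, lineGraph_adj_iff_exists, scalar_apply, diagonal_apply_ne _ hee, add_zero,
      ite_zero_mul_ite_zero, mul_one]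
    split_ifs with h
    · obtain ⟨-, v, hv, hv'⟩ := h
      rw [Finset.sum_eq_single_of_mem v (Finset.mem_univ v), if_pos ⟨hv, hv'⟩]
      intro w _ hwv
      refine if_neg fun hw => hee (Subtype.ext ?_)
      exact Sym2.eq_of_ne_mem hwv hw.1 hv hw.2 hv'
    · refine Finset.sum_eq_zero fun v _ => if_neg fun hv => h ⟨hee, v, hv⟩

theorem transpose_edgeIncMatrix_mul_one_mul :
    G.edgeIncMatrixᵀ * ((of fun _ _ => 1 : Matrix V V ℝ) * G.edgeIncMatrix) = of fun _ _ => 4 := by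
  have h (e : G.edgeSet) : ∑ v, G.edgeIncMatrix v e = 2 :=
    G.sum_incMatrix_apply_of_mem_edgeSet e.2
  ext e e'
  simp only [Matrix.mul_apply, transpose_apply, of_apply, one_mul, h, ← Finset.sum_mul]
  norm_num

theorem charpoly_adjMatrix_lineGraph [DecidableRel G.lineGraph.Adj]
    (h : Fintype.card V ≤ Fintype.card G.edgeSet) :
    (G.lineGraph.adjMatrix ℝ).charpoly =
      (X ^ (Fintype.card G.edgeSet - Fintype.card V) *
        (diagonal (fun v => (G.degree v : ℝ)) + G.adjMatrix ℝ).charpoly).comp (X + C 2) := by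
  rw [← edgeIncMatrix_mul_transpose, ← charpoly_mul_comm_of_le _ _ h, ← charpoly_sub_scalar,
    edgeIncMatrix_transpose_mul, add_sub_cancel_right]

theorem charpoly_adjMatrix_compl_lineGraph [DecidableRel G.lineGraph.Adj]
    (h : Fintype.card V ≤ Fintype.card G.edgeSet) :
    (G.lineGraphᶜ.adjMatrix ℝ).charpoly =
      (X ^ (Fintype.card G.edgeSet - Fintype.card V) *
        ((of fun _ v => (G.degree v : ℝ) / 2) -
          (diagonal (fun v => (G.degree v : ℝ)) + G.adjMatrix ℝ)).charpoly).comp (X + C (-1)) := by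
  set B := G.edgeIncMatrix
  have hcompl : G.lineGraphᶜ.adjMatrix ℝ =
      B.transpose * (((4⁻¹ : ℝ) • (of fun _ _ => 1 : Matrix V V ℝ) - 1) * B) - scalar _ (-1) := by
    rw [Matrix.sub_mul, Matrix.mul_sub, Matrix.smul_mul, Matrix.mul_smul,
      transpose_edgeIncMatrix_mul_one_mul, Matrix.one_mul, edgeIncMatrix_transpose_mul]
    ext e e'
    by_cases hee : e = e'
    · subst hee
      simp
      norm_num
    · by_cases h : G.lineGraph.Adj e e' <;> simp [hee, h]
  have hmul : ((4⁻¹ : ℝ) • (of fun _ _ => 1 : Matrix V V ℝ) - 1) * B * B.transpose =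
      (of fun _ v => (G.degree v : ℝ) / 2) -
          (diagonal (fun v => (G.degree v : ℝ)) + G.adjMatrix ℝ) := by
    rw [Matrix.mul_assoc, edgeIncMatrix_mul_transpose, Matrix.sub_mul, Matrix.one_mul]
    congr 1
    ext u v
    have hdeg : ∑ w, (if G.Adj w v then (1 : ℝ) else 0) = G.degree v := by
      simp [Finset.sum_boole, ← card_neighborFinset_eq_degree, neighborFinset_eq_filter, adj_comm]
    simp only [Matrix.mul_apply, Matrix.smul_apply, of_apply, Matrix.add_apply, smul_eq_mul,
      diagonal_apply, adjMatrix_apply, mul_one, ← Finset.mul_sum, Finset.sum_add_distrib,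
      Finset.sum_ite_eq', Finset.mem_univ, if_true, hdeg]
    ring
  rw [hcompl, charpoly_sub_scalar, charpoly_mul_comm_of_le _ _ h, hmul]

end SimpleGraph

theorem Finset.prod_comp_eq_prod_pow_card_fiber {V ι M : Type*} [Fintype V] [Fintype ι]
    [DecidableEq ι] [CommMonoid M] (f : V → ι) (g : ι → M) :
    ∏ v, g (f v) = ∏ c, g c ^ #{v | f v = c} := by
  rw [← Finset.prod_fiberwise (g := f)]
  refine Finset.prod_congr rfl fun c _ => ?_
  rw [Finset.prod_congr rfl fun v hv => by rw [(Finset.mem_filter.mp hv).2], Finset.prod_const]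

theorem Finset.sum_comp_eq_sum_card_fiber_mul {V ι R : Type*} [Fintype V] [Fintype ι]
    [DecidableEq ι] [Semiring R] (f : V → ι) (g : ι → R) :
    ∑ v, g (f v) = ∑ c, (#{v | f v = c} : R) * g c := by
  rw [← Finset.sum_fiberwise (g := f)]
  refine Finset.sum_congr rfl fun c _ => ?_
  rw [Finset.sum_congr rfl fun v hv => by rw [(Finset.mem_filter.mp hv).2], Finset.sum_const,
    nsmul_eq_mul]

namespace KpPlusTwoP

/-- The block of a vertex of `KpPlusTwoP p`: `0` inside `K_{p+2}`, `1` inside `K_p`, and `2` for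
the common vertex. -/
def block (p : ℕ) (v : Fin (2 * p + 1)) : Fin 3 :=
  if (v : ℕ) < p + 1 then 0 else if (v : ℕ) = p + 1 then 2 else 1

/-- Adjacency between the blocks of `KpPlusTwoP p`. -/
def blockAdj : Matrix (Fin 3) (Fin 3) ℝ := !![1, 0, 1; 0, 1, 1; 1, 1, 1]

/-- The degree of a vertex of `KpPlusTwoP p` in a given block. -/
def blockDegree (p : ℕ) : Fin 3 → ℝ := ![p + 1, p - 1, 2 * p]

theorem card_block_zero {p : ℕ} (hp : 2 ≤ p) : #{v | block p v = 0} = p + 1 := by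
  have h (v : Fin (2 * p + 1)) : block p v = 0 ↔ (v : ℕ) < p + 1 := by
    unfold block
    split_ifs <;> simp_all
  simp only [h]
  rw [Fin.card_filter_val_lt]
  omega

theorem card_block_two {p : ℕ} (hp : 2 ≤ p) : #{v | block p v = 2} = 1 := by
  rw [Finset.card_eq_one]
  refine ⟨⟨p + 1, by omega⟩, ?_⟩
  ext v
  simp only [Finset.mem_filter, Finset.mem_univ, true_and, block, Finset.mem_singleton, Fin.ext_iff]
  split_ifs <;> simp <;> omega

theorem card_block_one {p : ℕ} (hp : 2 ≤ p) : #{v | block p v = 1} = p - 1 := by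
  have h := Finset.card_eq_sum_card_fiberwise (f := block p) (s := Finset.univ)
    (t := Finset.univ) (by simp)
  rw [Fin.sum_univ_three, card_block_zero hp, card_block_two hp, Finset.card_univ,
    Fintype.card_fin] at h
  omega

theorem card_block {p : ℕ} (hp : 2 ≤ p) (c : Fin 3) :
    (#{v | block p v = c} : ℝ) = ![(p : ℝ) + 1, p - 1, 1] c := by
  fin_cases c
  · simp [card_block_zero hp]
  · simp [card_block_one hp, Nat.cast_sub (show 1 ≤ p by omega)]
  · simp [card_block_two hp]

theorem adj_iff {p : ℕ} {i j : Fin (2 * p + 1)} : (KpPlusTwoP p).Adj i j ↔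
    i ≠ j ∧ (block p i = block p j ∨ block p i = 2 ∨ block p j = 2) := by
  simp only [KpPlusTwoP, SimpleGraph.fromRel_adj, block]
  refine and_congr_right fun _ => ?_
  split_ifs <;> simp <;> omega

theorem blockAdj_apply (a b : Fin 3) :
    blockAdj a b = if a = b ∨ a = 2 ∨ b = 2 then 1 else 0 := by
  fin_cases a <;> fin_cases b <;> simp [blockAdj]

variable (p : ℕ) [DecidableRel (KpPlusTwoP p).Adj]

theorem adjMatrix_eq :
    (KpPlusTwoP p).adjMatrix ℝ = blockAdj.submatrix (block p) (block p) - 1 := by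
  ext i j
  by_cases hij : i = j <;>
    simp [SimpleGraph.adjMatrix_apply, adj_iff, blockAdj_apply, hij]

variable {p}

theorem degree_eq (hp : 2 ≤ p) (v : Fin (2 * p + 1)) :
    ((KpPlusTwoP p).degree v : ℝ) = blockDegree p (block p v) := by
  have h := (KpPlusTwoP p).adjMatrix_mulVec_const_apply (α := ℝ) (a := 1) (v := v)
  rw [mul_one] at h
  rw [← h, adjMatrix_eq, Matrix.sub_mulVec, Matrix.one_mulVec, Pi.sub_apply]
  simp only [Matrix.mulVec, dotProduct, submatrix_apply, Function.const_apply, mul_one]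
  rw [Finset.sum_comp_eq_sum_card_fiber_mul (block p) (fun c => blockAdj (block p v) c)]
  simp only [card_block hp, Fin.sum_univ_three]
  generalize block p v = c
  fin_cases c <;> simp [blockAdj, blockDegree]
  ring

theorem card_edgeSet (hp : 2 ≤ p) :
    Fintype.card (KpPlusTwoP p).edgeSet = p * (p - 1) + (2 * p + 1) := by
  have h := (KpPlusTwoP p).sum_degrees_eq_twice_card_edges
  rw [SimpleGraph.edgeFinset_card] at h
  have h' := congrArg (Nat.cast (R := ℝ)) h
  push_cast at h'
  simp only [degree_eq hp] at h'
  rw [Finset.sum_comp_eq_sum_card_fiber_mul (block p)] at h'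
  simp only [card_block hp, Fin.sum_univ_three, blockDegree] at h'
  rify [show 1 ≤ p by omega]
  generalize (Fintype.card (KpPlusTwoP p).edgeSet : ℝ) = m at h' ⊢
  simp at h'
  linarith

/-- The charpoly of a matrix which is constant on blocks up to its diagonal. -/
theorem charpoly_block (hp : 2 ≤ p) (d : Fin 3 → ℝ) (K : Matrix (Fin 3) (Fin 3) ℝ) :
    (diagonal (d ∘ block p) + K.submatrix (block p) (block p)).charpoly =
      (X - C (d 0)) ^ p * (X - C (d 1)) ^ (p - 2) *
        (diagonal d + K * diagonal ![(p : ℝ) + 1, p - 1, 1]).charpoly := by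
  have h := charpoly_diagonal_add_submatrix_mul_prod (block p) d K
  rw [Finset.prod_comp_eq_prod_pow_card_fiber (block p) fun c => X - C (d c), Fin.prod_univ_three,
    Fin.prod_univ_three, card_block_zero hp, card_block_one hp, card_block_two hp] at h
  simp only [card_block hp] at h
  have hne : (X - C (d 0)) * (X - C (d 1)) * (X - C (d 2)) ≠ 0 := by
    simp [X_sub_C_ne_zero]
  refine mul_right_cancel₀ hne (h.trans ?_)
  obtain ⟨q, rfl⟩ := Nat.exists_eq_add_of_le' hp
  simp only [Nat.add_sub_cancel, show q + 2 - 1 = q + 1 by omega]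
  change _ * (diagonal d + K * diagonal ![((q + 2 : ℕ) : ℝ) + 1, (q + 2 : ℕ) - 1, 1]).charpoly = _
  ring

theorem charpoly_signless (hp : 2 ≤ p) {s : ℝ} (hs : s ^ 2 = 8 * p + 17) :
    (diagonal (fun v => ((KpPlusTwoP p).degree v : ℝ)) + (KpPlusTwoP p).adjMatrix ℝ).charpoly =
      (X - C (p : ℝ)) ^ p * (X - C (p - 2 : ℝ)) ^ (p - 2) *
        ((X - C (2 * p - 1 : ℝ)) * (X - C (2 * p + (-1 + s) / 2)) *
          (X - C (2 * p + (-1 - s) / 2))) := by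
  have h : diagonal (fun v => ((KpPlusTwoP p).degree v : ℝ)) + (KpPlusTwoP p).adjMatrix ℝ =
      diagonal (![(p : ℝ), p - 2, 2 * p - 1] ∘ block p) +
        blockAdj.submatrix (block p) (block p) := by
    rw [adjMatrix_eq, ← diagonal_one, add_sub, sub_eq_iff_eq_add, add_right_comm, diagonal_add]
    congr 2
    funext v
    rw [degree_eq hp, Function.comp_apply]
    generalize block p v = c
    fin_cases c <;> simp [blockDegree]
    ring
  rw [h, charpoly_block hp]
  congr 1
  refine Polynomial.funext fun t => ?_
  simp only [eval_charpoly, det_fin_three, Matrix.sub_apply, Matrix.add_apply, Matrix.mul_diagonal,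
    scalar_apply, diagonal_apply]
  simp [blockAdj]
  linear_combination (t - 2 * p + 1) / 4 * hs

theorem charpoly_degree_sub_signless (hp : 2 ≤ p) :
    ((of fun _ v => ((KpPlusTwoP p).degree v : ℝ) / 2) -
      (diagonal (fun v => ((KpPlusTwoP p).degree v : ℝ)) +
        (KpPlusTwoP p).adjMatrix ℝ)).charpoly =
      (X - C (-p : ℝ)) ^ p * (X - C (2 - p : ℝ)) ^ (p - 2) *
        ((X - C (1 - 2 * p : ℝ)) * (X - C (p * (p - 1) - 1 : ℝ)) * (X - C (3 - 2 * p : ℝ))) := by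
  have h : (of fun _ v => ((KpPlusTwoP p).degree v : ℝ) / 2) -
      (diagonal (fun v => ((KpPlusTwoP p).degree v : ℝ)) + (KpPlusTwoP p).adjMatrix ℝ) =
      diagonal (![-(p : ℝ), 2 - p, 1 - 2 * p] ∘ block p) +
        ((of fun _ c => blockDegree p c / 2) - blockAdj).submatrix (block p) (block p) := by
    rw [adjMatrix_eq]
    ext i j
    simp only [degree_eq hp, Matrix.sub_apply, Matrix.add_apply, of_apply, submatrix_apply]
    by_cases hij : i = j
    · subst hij
      simp only [diagonal_apply_eq, Matrix.one_apply_eq, Function.comp_apply]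
      generalize block p i = c
      fin_cases c <;> simp [blockDegree] <;> ring
    · simp [hij]
  rw [h, charpoly_block hp]
  congr 1
  refine Polynomial.funext fun t => ?_
  simp only [eval_charpoly, det_fin_three, Matrix.sub_apply, Matrix.add_apply, Matrix.mul_diagonal,
    scalar_apply, diagonal_apply, of_apply]
  simp [blockAdj, blockDegree]
  ring

end KpPlusTwoP

theorem energy_lineGraph_KpPlusTwoP {p : ℕ} (hp : 4 ≤ p) :
    energy (KpPlusTwoP p).lineGraph = 4 * p * (p - 1) := by
  classical
  set s := √(8 * p + 17 : ℝ)
  have hs : s ^ 2 = 8 * p + 17 := Real.sq_sqrt (by positivity)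
  have hs0 : 0 ≤ s := Real.sqrt_nonneg _
  have hp' : (4 : ℝ) ≤ p := by exact_mod_cast hp
  have hs1 : s ≤ 4 * p - 5 := by nlinarith
  have hcard := KpPlusTwoP.card_edgeSet (p := p) (by omega)
  rw [energy_eq_sum_abs_of_charpoly_eq _ (.replicate (p * (p - 1)) (-2) +
    .replicate p (p - 2 : ℝ) + .replicate (p - 2) (p - 4 : ℝ) +
    {(2 * p - 3 : ℝ), 2 * p - 2 + (-1 + s) / 2, 2 * p - 2 + (-1 - s) / 2})]
  · simp only [Multiset.map_add, Multiset.map_replicate, Multiset.sum_add, Multiset.sum_replicate,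
      Multiset.insert_eq_cons, Multiset.map_cons, Multiset.map_singleton, Multiset.sum_cons,
      Multiset.sum_singleton, nsmul_eq_mul]
    rw [abs_of_nonpos (by norm_num : (-2 : ℝ) ≤ 0), abs_of_nonneg (by linarith : (0 : ℝ) ≤ p - 2),
      abs_of_nonneg (by linarith : (0 : ℝ) ≤ p - 4),
      abs_of_nonneg (by linarith : (0 : ℝ) ≤ 2 * p - 3),
      abs_of_nonneg (by linarith : 0 ≤ 2 * p - 2 + (-1 + s) / 2),
      abs_of_nonneg (by linarith : 0 ≤ 2 * p - 2 + (-1 - s) / 2)]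
    push_cast [show 1 ≤ p by omega, show 2 ≤ p by omega]
    ring
  · rw [SimpleGraph.charpoly_adjMatrix_lineGraph _ (by rw [hcard, Fintype.card_fin]; omega),
      KpPlusTwoP.charpoly_signless (by omega) hs, hcard, Fintype.card_fin, Nat.add_sub_cancel]
    refine Polynomial.funext fun t => ?_
    simp only [Multiset.map_add, Multiset.map_replicate, Multiset.prod_add,
      Multiset.prod_replicate, Multiset.insert_eq_cons, Multiset.map_cons, Multiset.map_singleton,
      Multiset.prod_cons, Multiset.prod_singleton, eval_comp, eval_mul, eval_pow, eval_sub,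
      eval_add, eval_X, eval_C]
    ring

theorem energy_compl_lineGraph_KpPlusTwoP {p : ℕ} (hp : 4 ≤ p) :
    energy (KpPlusTwoP p).lineGraphᶜ = 4 * p * (p - 1) := by
  classical
  have hp' : (4 : ℝ) ≤ p := by exact_mod_cast hp
  have hcard := KpPlusTwoP.card_edgeSet (p := p) (by omega)
  rw [energy_eq_sum_abs_of_charpoly_eq _ (.replicate (p * (p - 1)) 1 +
    .replicate p (1 - p : ℝ) + .replicate (p - 2) (3 - p : ℝ) +
    {(2 - 2 * p : ℝ), (p * (p - 1) : ℝ), (4 - 2 * p : ℝ)})]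
  · simp only [Multiset.map_add, Multiset.map_replicate, Multiset.sum_add, Multiset.sum_replicate,
      Multiset.insert_eq_cons, Multiset.map_cons, Multiset.map_singleton, Multiset.sum_cons,
      Multiset.sum_singleton, nsmul_eq_mul]
    rw [abs_one, abs_of_nonpos (by linarith : (1 - p : ℝ) ≤ 0),
      abs_of_nonpos (by linarith : (3 - p : ℝ) ≤ 0),
      abs_of_nonpos (by linarith : (2 - 2 * p : ℝ) ≤ 0),
      abs_of_nonneg (by nlinarith : (0 : ℝ) ≤ p * (p - 1)),
      abs_of_nonpos (by linarith : (4 - 2 * p : ℝ) ≤ 0)]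
    push_cast [show 1 ≤ p by omega, show 2 ≤ p by omega]
    ring
  · rw [SimpleGraph.charpoly_adjMatrix_compl_lineGraph _
        (by rw [hcard, Fintype.card_fin]; omega),
      KpPlusTwoP.charpoly_degree_sub_signless (by omega), hcard, Fintype.card_fin,
      Nat.add_sub_cancel]
    refine Polynomial.funext fun t => ?_
    simp only [Multiset.map_add, Multiset.map_replicate, Multiset.prod_add,
      Multiset.prod_replicate, Multiset.insert_eq_cons, Multiset.map_cons, Multiset.map_singleton,
      Multiset.prod_cons, Multiset.prod_singleton, eval_comp, eval_mul, eval_pow, eval_sub,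
      eval_add, eval_X, eval_C]
    ring

theorem energy_lineGraph_KpPlusTwoP_eq_energy_compl (p : ℕ) (hp : 4 ≤ p) :
    energy (KpPlusTwoP p).lineGraph = energy ((KpPlusTwoP p).lineGraph)ᶜ := by
  rw [energy_lineGraph_KpPlusTwoP hp, energy_compl_lineGraph_KpPlusTwoP hp]
end

section
/- If G is a simple graph on at most 5 vertices that is not isomorphic to its complement and satisfies E(G) = E(Ḡ), then G has exactly 4 vertices and G is isomorphic either to the 4-cycle C_4 or to its complement, the disjoint union of two edges K_2 ∪ K_2. In particular, up to isomorphism, (C_4, K_2 ∪ K_2) is the unique pair of complementary equienergetic graphs of order at most 5. -/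
open Polynomial

/-- The quintic `X⁵ + c₃X³ + c₂X² + c₁X + c₀` attached to the coefficients `(c₃, c₂, c₁, c₀)`. -/
noncomputable def depressedQuintic (c : ℤ × ℤ × ℤ × ℤ) : ℝ[X] :=
  X ^ 5 + (c.1 : ℝ[X]) * X ^ 3 + (c.2.1 : ℝ[X]) * X ^ 2 + (c.2.2.1 : ℝ[X]) * X + (c.2.2.2 : ℝ[X])

/-- The sum of the absolute values of the real roots of a polynomial. -/
noncomputable def rootAbsSum (p : ℝ[X]) : ℝ := (p.roots.map (fun x => |x|)).sum

theorem rootAbsSum_nonneg (p : ℝ[X]) : 0 ≤ rootAbsSum p := by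
  refine Multiset.sum_nonneg fun x hx => ?_
  obtain ⟨y, -, rfl⟩ := Multiset.mem_map.1 hx
  exact abs_nonneg y

theorem rootAbsSum_X_pow_mul {p : ℝ[X]} (hp : p ≠ 0) (k : ℕ) :
    rootAbsSum (X ^ k * p) = rootAbsSum p := by
  unfold rootAbsSum
  rw [roots_mul (mul_ne_zero (pow_ne_zero _ X_ne_zero) hp), roots_X_pow]
  simp [Multiset.nsmul_singleton]

section Quintic

variable {c : ℤ × ℤ × ℤ × ℤ}

theorem natDegree_depressedQuintic (c : ℤ × ℤ × ℤ × ℤ) : (depressedQuintic c).natDegree = 5 := by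
  unfold depressedQuintic
  compute_degree!

theorem monic_depressedQuintic (c : ℤ × ℤ × ℤ × ℤ) : (depressedQuintic c).Monic := by
  unfold depressedQuintic
  monicity!

theorem eval_depressedQuintic (c : ℤ × ℤ × ℤ × ℤ) (x : ℝ) :
    (depressedQuintic c).eval x = x ^ 5 + c.1 * x ^ 3 + c.2.1 * x ^ 2 + c.2.2.1 * x + c.2.2.2 := by
  simp [depressedQuintic]

theorem exists_roots_depressedQuintic (hs : (depressedQuintic c).Splits) :
    ∃ a₁ a₂ a₃ a₄ a₅ : ℝ, (depressedQuintic c).roots = {a₁, a₂, a₃, a₄, a₅} ∧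
      a₁ + a₂ + a₃ + a₄ + a₅ = 0 ∧
      a₁ * a₂ + a₁ * a₃ + a₁ * a₄ + a₁ * a₅ + a₂ * a₃ + a₂ * a₄ + a₂ * a₅ + a₃ * a₄ + a₃ * a₅
        + a₄ * a₅ = c.1 := by
  have hcard : (depressedQuintic c).roots.card = 5 := by
    rw [← hs.natDegree_eq_card_roots, natDegree_depressedQuintic]
  obtain ⟨a₁, s, h₁, hs₁⟩ := Multiset.card_eq_succ_iff.1 hcard
  obtain ⟨a₂, s, rfl, hs₂⟩ := Multiset.card_eq_succ_iff.1 hs₁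
  obtain ⟨a₃, a₄, a₅, rfl⟩ := Multiset.card_eq_three.1 hs₂
  have heq : ∀ x : ℝ, x ^ 5 + c.1 * x ^ 3 + c.2.1 * x ^ 2 + c.2.2.1 * x + c.2.2.2
      = (x - a₁) * (x - a₂) * (x - a₃) * (x - a₄) * (x - a₅) := fun x => by
    rw [← eval_depressedQuintic, hs.eval_eq_prod_roots_of_monic (monic_depressedQuintic c), ← h₁]
    simp [mul_assoc]
  have h0 := heq 0
  have h1 := heq 1
  have h2 := heq (-1)
  have h3 := heq 2
  have h4 := heq (-2)
  exact ⟨a₁, a₂, a₃, a₄, a₅, h₁.symm, by linarith, by linarith⟩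

theorem sum_roots_depressedQuintic (hs : (depressedQuintic c).Splits) :
    (depressedQuintic c).roots.sum = 0 := by
  obtain ⟨a₁, a₂, a₃, a₄, a₅, h, hsum, -⟩ := exists_roots_depressedQuintic hs
  rw [h]
  simpa [add_assoc] using hsum

theorem sum_sq_roots_depressedQuintic (hs : (depressedQuintic c).Splits) :
    ((depressedQuintic c).roots.map (fun x => x ^ 2)).sum = -2 * (c.1 : ℝ) := by
  obtain ⟨a₁, a₂, a₃, a₄, a₅, h, hsum, hpair⟩ := exists_roots_depressedQuintic hs
  rw [h, ← hpair]
  simp only [Multiset.insert_eq_cons, Multiset.map_cons, Multiset.map_singleton,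
    Multiset.sum_cons, Multiset.sum_singleton]
  linear_combination (a₁ + a₂ + a₃ + a₄ + a₅) * hsum

theorem rootAbsSum_sq_ge (hs : (depressedQuintic c).Splits) :
    -4 * (c.1 : ℝ) ≤ rootAbsSum (depressedQuintic c) ^ 2 := by
  obtain ⟨a₁, a₂, a₃, a₄, a₅, h, hsum, hpair⟩ := exists_roots_depressedQuintic hs
  rw [rootAbsSum, h, ← hpair]
  simp only [Multiset.insert_eq_cons, Multiset.map_cons, Multiset.map_singleton,
    Multiset.sum_cons, Multiset.sum_singleton]
  have key (x y : ℝ) : -(x * y) ≤ |x| * |y| := abs_mul x y ▸ neg_le_abs (x * y)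
  have hsq : a₁ ^ 2 + a₂ ^ 2 + a₃ ^ 2 + a₄ ^ 2 + a₅ ^ 2
      = -2 * (a₁ * a₂ + a₁ * a₃ + a₁ * a₄ + a₁ * a₅ + a₂ * a₃ + a₂ * a₄ + a₂ * a₅ + a₃ * a₄
        + a₃ * a₅ + a₄ * a₅) := by
    linear_combination (a₁ + a₂ + a₃ + a₄ + a₅) * hsum
  linarith [key a₁ a₂, key a₁ a₃, key a₁ a₄, key a₁ a₅, key a₂ a₃, key a₂ a₄, key a₂ a₅,
    key a₃ a₄, key a₃ a₅, key a₄ a₅, sq_abs a₁, sq_abs a₂, sq_abs a₃, sq_abs a₄, sq_abs a₅]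

/-- The degree left after removing the powers of `X` dividing the quintic. -/
def nonzeroRootCount (c : ℤ × ℤ × ℤ × ℤ) : ℕ :=
  if c.2.2.2 ≠ 0 then 5 else if c.2.2.1 ≠ 0 then 4 else if c.2.1 ≠ 0 then 3
  else if c.1 ≠ 0 then 2 else 0

theorem X_pow_dvd_depressedQuintic (c : ℤ × ℤ × ℤ × ℤ) :
    X ^ (5 - nonzeroRootCount c) ∣ depressedQuintic c := by
  obtain ⟨q, s, t, u⟩ := c
  unfold nonzeroRootCount depressedQuintic
  dsimp only
  split_ifs with h₀ h₁ h₂ h₃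
  · simp
  · obtain rfl : u = 0 := not_not.1 h₀
    exact ⟨X ^ 4 + (q : ℝ[X]) * X ^ 2 + (s : ℝ[X]) * X + (t : ℝ[X]), by push_cast; ring⟩
  · obtain rfl : u = 0 := not_not.1 h₀
    obtain rfl : t = 0 := not_not.1 h₁
    exact ⟨X ^ 3 + (q : ℝ[X]) * X + (s : ℝ[X]), by push_cast; ring⟩
  · obtain rfl : u = 0 := not_not.1 h₀
    obtain rfl : t = 0 := not_not.1 h₁
    obtain rfl : s = 0 := not_not.1 h₂
    exact ⟨X ^ 2 + (q : ℝ[X]), by push_cast; ring⟩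
  · obtain rfl : u = 0 := not_not.1 h₀
    obtain rfl : t = 0 := not_not.1 h₁
    obtain rfl : s = 0 := not_not.1 h₂
    obtain rfl : q = 0 := not_not.1 h₃
    simp

/-- A form of the Cauchy–Schwarz (McClelland) bound taking zero roots into account. -/
theorem rootAbsSum_sq_le (hs : (depressedQuintic c).Splits) :
    rootAbsSum (depressedQuintic c) ^ 2 ≤ -2 * (c.1 : ℝ) * nonzeroRootCount c := by
  set p := depressedQuintic c with hp
  set k := nonzeroRootCount c
  have hp0 : p ≠ 0 := (monic_depressedQuintic c).ne_zero
  have hcount : (p.roots.filter (· ≠ 0)).card ≤ k := by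
    have h₁ : 5 - k ≤ p.roots.count 0 := by
      rw [count_roots, le_rootMultiplicity_iff hp0]
      simpa using X_pow_dvd_depressedQuintic c
    have h₂ : p.roots.card = 5 := by
      rw [← hs.natDegree_eq_card_roots, natDegree_depressedQuintic]
    have h₃ := congrArg Multiset.card (Multiset.filter_add_not (· ≠ 0) p.roots)
    have h₄ : (p.roots.filter (fun a => ¬ a ≠ 0)).card = p.roots.count 0 := by
      rw [Multiset.count_eq_card_filter_eq]
      simp [eq_comm]
    rw [Multiset.card_add, h₄] at h₃
    omega
  have key (t : ℝ) : 2 * t * rootAbsSum p ≤ -2 * (c.1 : ℝ) + t ^ 2 * k := by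
    have h₁ : (p.roots.map fun x => 2 * t * |x|).sum
        ≤ (p.roots.map fun x => x ^ 2 + t ^ 2 * if x ≠ 0 then 1 else 0).sum := by
      refine Multiset.sum_map_le_sum_map _ _ fun x _ => ?_
      split_ifs with hx
      · nlinarith [sq_nonneg (t - |x|), sq_abs x]
      · simp [not_not.1 hx]
    have h₂ : (p.roots.map fun x : ℝ => if x ≠ 0 then (1 : ℝ) else 0).sum
        = (p.roots.filter (· ≠ 0)).card := by
      rw [← Multiset.countP_eq_card_filter]
      induction p.roots using Multiset.induction_on with
      | empty => simp
      | cons a s ih =>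
        simp only [Multiset.map_cons, Multiset.sum_cons, ih, Multiset.countP_cons]
        split_ifs <;> push_cast <;> ring
    rw [Multiset.sum_map_mul_left, Multiset.sum_map_add, Multiset.sum_map_mul_left, h₂,
      sum_sq_roots_depressedQuintic hs] at h₁
    have h₃ : ((p.roots.filter (· ≠ 0)).card : ℝ) ≤ k := by exact_mod_cast hcount
    exact h₁.trans (by gcongr)
  rcases Nat.eq_zero_or_pos k with hk | hk
  · have hq : rootAbsSum p = 0 := by
      have h₁ := key (-2 * c.1 + 1)
      have h₂ := key (-2 * c.1)
      have h₃ := rootAbsSum_nonneg p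
      rw [hk] at h₁ h₂
      have hc : c.1 = 0 := by
        by_contra hc
        have : k ≠ 0 := by
          simp only [k, nonzeroRootCount, if_pos hc]
          split_ifs <;> omega
        exact this hk
      rw [hc] at h₁
      norm_num at h₁
      linarith
    simp [hq, hk]
  · have hk' : (0 : ℝ) < k := by exact_mod_cast hk
    have h₁ := key (rootAbsSum p / k)
    have h₂ : 2 * (rootAbsSum p / k) * rootAbsSum p = 2 * (rootAbsSum p ^ 2 / k) := by ring
    have h₃ : (rootAbsSum p / k) ^ 2 * k = rootAbsSum p ^ 2 / k := by field_simp
    rw [h₂, h₃] at h₁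
    rw [← div_le_iff₀ hk']
    linarith

theorem exists_mem_roots_mem_Icc {p : ℝ[X]} (hp : p ≠ 0) {l u : ℝ} (hlu : l ≤ u)
    (h : p.eval l * p.eval u ≤ 0) : ∃ x ∈ p.roots, x ∈ Set.Icc l u := by
  have h0 : (0 : ℝ) ∈ Set.uIcc (p.eval l) (p.eval u) := by
    rw [Set.mem_uIcc]
    rcases le_total (p.eval l) 0 with h₁ | h₁ <;> rcases le_total (p.eval u) 0 with h₂ | h₂
    · rcases mul_eq_zero.1 (le_antisymm h (mul_nonneg_of_nonpos_of_nonpos h₁ h₂)) with h₃ | h₃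
      · exact Or.inr ⟨h₂, h₃.ge⟩
      · exact Or.inl ⟨h₁, h₃.ge⟩
    · exact Or.inl ⟨h₁, h₂⟩
    · exact Or.inr ⟨h₂, h₁⟩
    · rcases mul_eq_zero.1 (le_antisymm h (mul_nonneg h₁ h₂)) with h₃ | h₃
      · exact Or.inl ⟨h₃.le, h₂⟩
      · exact Or.inr ⟨h₃.le, h₁⟩
  obtain ⟨x, hx, hx0⟩ := intermediate_value_uIcc p.continuousOn h0
  rw [Set.uIcc_of_le hlu] at hx
  exact ⟨x, (mem_roots hp).2 hx0, hx⟩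

/-- Two distinct roots located by sign changes bound the sum of absolute values from below. -/
theorem le_rootAbsSum_of_sign_changes (hs : (depressedQuintic c).Splits) {l₁ u₁ l₂ u₂ : ℝ}
    (h₁ : l₁ ≤ u₁) (h₁₂ : u₁ < l₂) (h₂ : l₂ ≤ u₂)
    (hr₁ : (depressedQuintic c).eval l₁ * (depressedQuintic c).eval u₁ ≤ 0)
    (hr₂ : (depressedQuintic c).eval l₂ * (depressedQuintic c).eval u₂ ≤ 0) :
    2 * (l₁ + l₂) ≤ rootAbsSum (depressedQuintic c) := by
  have hp := (monic_depressedQuintic c).ne_zero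
  obtain ⟨x, hx, hx'⟩ := exists_mem_roots_mem_Icc hp h₁ hr₁
  obtain ⟨y, hy, hy'⟩ := exists_mem_roots_mem_Icc hp h₂ hr₂
  have hxy : y ≠ x := (hx'.2.trans_lt (h₁₂.trans_le hy'.1)).ne'
  have hsum := sum_roots_depressedQuintic hs
  obtain ⟨s, hs'⟩ := Multiset.exists_cons_of_mem hx
  rw [hs', Multiset.mem_cons, or_iff_right hxy] at hy
  obtain ⟨t, rfl⟩ := Multiset.exists_cons_of_mem hy
  rw [rootAbsSum, hs']
  rw [hs'] at hsum
  simp only [Multiset.map_cons, Multiset.sum_cons] at hsum ⊢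
  have ht := Multiset.abs_sum_le_sum_abs (s := t)
  linarith [neg_le_abs t.sum, le_abs_self x, le_abs_self y, hx'.1, hy'.1]

/-- A lower bound for the square of the sum of the absolute values of the roots. -/
def absSumSqLowerBound (c : ℤ × ℤ × ℤ × ℤ) : ℤ :=
  if c = (-6, -4, 2, 0) then 33 else if c = (-6, -4, 3, 2) then 33
  else if c = (-6, -2, 4, 0) then 33 else if c = (-5, -2, 2, 0) then 31
  else if c = (-5, -2, 4, 2) then 41 else if c = (-4, -2, 3, 2) then 36
  else if c = (-3, -2, 0, 0) then 16 else -4 * c.1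

theorem absSumSqLowerBound_le (hs : (depressedQuintic c).Splits) :
    (absSumSqLowerBound c : ℝ) ≤ rootAbsSum (depressedQuintic c) ^ 2 := by
  have key {l₁ u₁ l₂ u₂ : ℝ} (m : ℝ) (h₁ : l₁ ≤ u₁) (h₁₂ : u₁ < l₂) (h₂ : l₂ ≤ u₂)
      (hr₁ : (depressedQuintic c).eval l₁ * (depressedQuintic c).eval u₁ ≤ 0)
      (hr₂ : (depressedQuintic c).eval l₂ * (depressedQuintic c).eval u₂ ≤ 0)
      (h0 : 0 ≤ 2 * (l₁ + l₂)) (hm : m ≤ (2 * (l₁ + l₂)) ^ 2) :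
      m ≤ rootAbsSum (depressedQuintic c) ^ 2 :=
    hm.trans (pow_le_pow_left₀ h0 (le_rootAbsSum_of_sign_changes hs h₁ h₁₂ h₂ hr₁ hr₂) 2)
  unfold absSumSqLowerBound
  split_ifs with h h h h h h h
  · subst h
    refine key (l₁ := 0.3) (u₁ := 0.4) (l₂ := 2.6) (u₂ := 2.7) _ ?_ ?_ ?_ ?_ ?_ ?_ ?_ <;>
      norm_num [eval_depressedQuintic]
  · subst h
    refine key (l₁ := 0.7) (u₁ := 0.8) (l₂ := 2.6) (u₂ := 2.7) _ ?_ ?_ ?_ ?_ ?_ ?_ ?_ <;>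
      norm_num [eval_depressedQuintic]
  · subst h
    refine key (l₁ := 0.6) (u₁ := 0.7) (l₂ := 2.4) (u₂ := 2.5) _ ?_ ?_ ?_ ?_ ?_ ?_ ?_ <;>
      norm_num [eval_depressedQuintic]
  · subst h
    refine key (l₁ := 0.46) (u₁ := 0.5) (l₂ := 2.34) (u₂ := 2.4) _ ?_ ?_ ?_ ?_ ?_ ?_ ?_ <;>
      norm_num [eval_depressedQuintic]
  · subst h
    refine key (l₁ := 1) (u₁ := 1) (l₂ := 2.21) (u₂ := 2.3) _ ?_ ?_ ?_ ?_ ?_ ?_ ?_ <;>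
      norm_num [eval_depressedQuintic]
  · subst h
    refine key (l₁ := 1) (u₁ := 1) (l₂ := 2) (u₂ := 2) _ ?_ ?_ ?_ ?_ ?_ ?_ ?_ <;>
      norm_num [eval_depressedQuintic]
  · subst h
    refine key (l₁ := 0) (u₁ := 0) (l₂ := 2) (u₂ := 2) _ ?_ ?_ ?_ ?_ ?_ ?_ ?_ <;>
      norm_num [eval_depressedQuintic]
  · exact_mod_cast rootAbsSum_sq_ge hs

end Quintic

/-- The integer bounds prove that the roots of the second quintic have smaller absolute sum. -/
abbrev BoundsSeparate (c c' : ℤ × ℤ × ℤ × ℤ) : Prop :=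
  -2 * c'.1 * nonzeroRootCount c' < absSumSqLowerBound c

theorem BoundsSeparate.rootAbsSum_ne {c c' : ℤ × ℤ × ℤ × ℤ} (h : BoundsSeparate c c')
    (hs : (depressedQuintic c).Splits) (hs' : (depressedQuintic c').Splits) :
    rootAbsSum (depressedQuintic c) ≠ rootAbsSum (depressedQuintic c') := by
  intro heq
  have h₁ := absSumSqLowerBound_le hs
  have h₂ := rootAbsSum_sq_le hs'
  have h₃ : (-2 * (c'.1 : ℝ) * nonzeroRootCount c') < absSumSqLowerBound c := by exact_mod_cast h
  rw [heq] at h₁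
  linarith

/-- The coefficients of the characteristic polynomial of a symmetric `5 × 5` matrix with zero
diagonal, the entries above the diagonal being listed column by column. -/
def symmCoeffs {R : Type*} [CommRing R] (a b c d e f g h i j : R) : R × R × R × R :=
  (-(a^2 + b^2 + c^2 + d^2 + e^2 + f^2 + g^2 + h^2 + i^2 + j^2),
   -2 * (a*b*c + a*d*e + a*g*h + b*d*f + b*g*i + d*g*j + c*e*f + c*h*i + e*h*j + f*i*j),
   a^2*f^2 + a^2*i^2 + a^2*j^2 + b^2*e^2 + b^2*h^2 + b^2*j^2 + c^2*d^2 + c^2*g^2 + c^2*j^2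
     + d^2*h^2 + d^2*i^2 + e^2*g^2 + e^2*i^2 + f^2*g^2 + f^2*h^2
     - 2 * (a*b*e*f + a*c*d*f + b*c*d*e + a*b*h*i + a*c*g*i + b*c*g*h + a*d*h*j + a*e*g*j
       + d*e*g*h + b*d*i*j + b*f*g*j + d*f*g*i + c*e*i*j + c*f*h*j + e*f*h*i),
   2 * (j^2*a*b*c + i^2*a*d*e + f^2*a*g*h + h^2*b*d*f + e^2*b*g*i + c^2*d*g*j + g^2*c*e*f
       + d^2*c*h*i + b^2*e*h*j + a^2*f*i*j)
     - 2 * (a*b*e*i*j + a*b*f*h*j + a*c*d*i*j + a*c*f*g*j + a*d*f*h*i + a*e*f*g*i + b*c*d*h*j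
       + b*c*e*g*j + b*d*e*h*i + b*e*f*g*h + c*d*e*g*i + c*d*f*g*h))

theorem det_symm_five {R : Type*} [CommRing R] (x a b c d e f g h i j : R) :
    Matrix.det !![x, -a, -b, -d, -g; -a, x, -c, -e, -h; -b, -c, x, -f, -i;
      -d, -e, -f, x, -j; -g, -h, -i, -j, x]
      = x ^ 5 + (symmCoeffs a b c d e f g h i j).1 * x ^ 3
        + (symmCoeffs a b c d e f g h i j).2.1 * x ^ 2
        + (symmCoeffs a b c d e f g h i j).2.2.1 * x + (symmCoeffs a b c d e f g h i j).2.2.2 := by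
  simp [Matrix.det_succ_row_zero, Fin.sum_univ_succ, Fin.succAbove, symmCoeffs]
  ring

theorem det_symm_four {R : Type*} [CommRing R] (x a b c d e f : R) :
    x * Matrix.det !![x, -a, -b, -d; -a, x, -c, -e; -b, -c, x, -f; -d, -e, -f, x]
      = x ^ 5 + (symmCoeffs a b c d e f 0 0 0 0).1 * x ^ 3
        + (symmCoeffs a b c d e f 0 0 0 0).2.1 * x ^ 2
        + (symmCoeffs a b c d e f 0 0 0 0).2.2.1 * x + (symmCoeffs a b c d e f 0 0 0 0).2.2.2 := by
  simp [Matrix.det_succ_row_zero, Fin.sum_univ_succ, Fin.succAbove, symmCoeffs]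
  ring

theorem det_symm_three {R : Type*} [CommRing R] (x a b c : R) :
    x ^ 2 * Matrix.det !![x, -a, -b; -a, x, -c; -b, -c, x]
      = x ^ 5 + (symmCoeffs a b c 0 0 0 0 0 0 0).1 * x ^ 3
        + (symmCoeffs a b c 0 0 0 0 0 0 0).2.1 * x ^ 2
        + (symmCoeffs a b c 0 0 0 0 0 0 0).2.2.1 * x + (symmCoeffs a b c 0 0 0 0 0 0 0).2.2.2 := by
  simp [Matrix.det_fin_three, symmCoeffs]
  ring

theorem det_symm_two {R : Type*} [CommRing R] (x a : R) :
    x ^ 3 * Matrix.det !![x, -a; -a, x]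
      = x ^ 5 + (symmCoeffs a 0 0 0 0 0 0 0 0 0).1 * x ^ 3
        + (symmCoeffs a 0 0 0 0 0 0 0 0 0).2.1 * x ^ 2
        + (symmCoeffs a 0 0 0 0 0 0 0 0 0).2.2.1 * x + (symmCoeffs a 0 0 0 0 0 0 0 0 0).2.2.2 := by
  simp [Matrix.det_fin_two, symmCoeffs]
  ring

/-- The value of `symmCoeffs` on the indicators of ten Booleans. -/
def boolCoeffs (a b c d e f g h i j : Bool) : ℤ × ℤ × ℤ × ℤ :=
  symmCoeffs a.toInt b.toInt c.toInt d.toInt e.toInt f.toInt g.toInt h.toInt i.toInt j.toInt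

theorem depressedQuintic_boolCoeffs (a b c d e f g h i j : Bool) :
    depressedQuintic (boolCoeffs a b c d e f g h i j) =
      X ^ 5 + (symmCoeffs (R := ℝ[X]) a.toInt b.toInt c.toInt d.toInt e.toInt f.toInt g.toInt
          h.toInt i.toInt j.toInt).1 * X ^ 3
        + (symmCoeffs (R := ℝ[X]) a.toInt b.toInt c.toInt d.toInt e.toInt f.toInt g.toInt
          h.toInt i.toInt j.toInt).2.1 * X ^ 2
        + (symmCoeffs (R := ℝ[X]) a.toInt b.toInt c.toInt d.toInt e.toInt f.toInt g.toInt
          h.toInt i.toInt j.toInt).2.2.1 * X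
        + (symmCoeffs (R := ℝ[X]) a.toInt b.toInt c.toInt d.toInt e.toInt f.toInt g.toInt
          h.toInt i.toInt j.toInt).2.2.2 := by
  simp only [depressedQuintic, boolCoeffs, symmCoeffs]
  push_cast
  rfl

theorem energy_eq_rootAbsSum {n : ℕ} (G : SimpleGraph (Fin n)) :
    energy G = rootAbsSum (adjMat G).charpoly := by
  unfold energy rootAbsSum
  congr!

theorem adjMat_apply {V : Type*} [Finite V] (G : SimpleGraph V) (u v : V) [Decidable (G.Adj u v)] :
    adjMat G u v = if G.Adj u v then 1 else 0 := by
  simp [adjMat, SimpleGraph.adjMatrix_apply]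

theorem isHermitian_adjMat {V : Type*} [Finite V] (G : SimpleGraph V) : (adjMat G).IsHermitian := by
  classical
  ext u v
  simp [adjMat_apply, G.adj_comm]

theorem energy_congr {V W : Type*} [Finite V] [Finite W] {G : SimpleGraph V} {H : SimpleGraph W}
    (φ : G ≃g H) : energy G = energy H := by
  classical
  let _ := Fintype.ofFinite V
  let _ := Fintype.ofFinite W
  have h : adjMat H = Matrix.reindex φ.toEquiv φ.toEquiv (adjMat G) := by
    ext u v
    simp only [adjMat_apply, ← φ.symm.map_adj_iff, Matrix.reindex_apply, Matrix.submatrix_apply]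
    congr!
  have h' := Matrix.charpoly_reindex φ.toEquiv (adjMat G)
  rw [← h] at h'
  unfold energy
  convert congrArg (fun p : ℝ[X] => (p.roots.map (fun x => |x|)).sum) h'.symm

/-- An isomorphism induces an isomorphism of the complements. -/
def complIso {V W : Type*} {G : SimpleGraph V} {H : SimpleGraph W} (φ : G ≃g H) : Gᶜ ≃g Hᶜ where
  toEquiv := φ.toEquiv
  map_rel_iff' := by simp [SimpleGraph.compl_adj, φ.map_adj_iff]

open Classical in
/-- The adjacency relation as a Boolean function. -/
noncomputable def adjBool {V : Type*} (G : SimpleGraph V) (u v : V) : Bool := decide (G.Adj u v)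

theorem adjBool_comm {V : Type*} (G : SimpleGraph V) (u v : V) : adjBool G u v = adjBool G v u := by
  simp [adjBool, G.adj_comm]

theorem adjBool_self {V : Type*} (G : SimpleGraph V) (u : V) : adjBool G u u = false := by
  simp [adjBool]

theorem adjBool_compl {V : Type*} (G : SimpleGraph V) {u v : V} (h : u ≠ v) :
    adjBool Gᶜ u v = !adjBool G u v := by
  by_cases h' : G.Adj u v <;> simp [adjBool, SimpleGraph.compl_adj, h, h']

theorem adjMat_eq_toInt {V : Type*} [Finite V] (G : SimpleGraph V) (u v : V) :
    adjMat G u v = ((adjBool G u v).toInt : ℝ) := by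
  classical
  rw [adjMat_apply]
  by_cases h : G.Adj u v <;> simp [adjBool, h]

theorem charmatrix_adjMat_apply {n : ℕ} (G : SimpleGraph (Fin n)) (u v : Fin n) :
    (adjMat G).charmatrix u v = if u = v then X else -((adjBool G u v).toInt : ℝ[X]) := by
  split_ifs with h
  · subst h
    simp [Matrix.charmatrix_apply_eq, adjMat_eq_toInt, adjBool_self]
  · rw [Matrix.charmatrix_apply_ne _ _ _ h, adjMat_eq_toInt]
    simp

/-- The quintic with coefficients `c` is the characteristic polynomial of `G` times a power of
`X`. -/
structure HasCoeffs {n : ℕ} (G : SimpleGraph (Fin n)) (c : ℤ × ℤ × ℤ × ℤ) : Prop where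
  exists_eq : ∃ k : ℕ, X ^ k * (adjMat G).charpoly = depressedQuintic c

theorem HasCoeffs.splits {n : ℕ} {G : SimpleGraph (Fin n)} {c : ℤ × ℤ × ℤ × ℤ}
    (h : HasCoeffs G c) : (depressedQuintic c).Splits := by
  obtain ⟨k, hk⟩ := h.exists_eq
  rw [← hk]
  exact (Splits.X_pow k).mul (isHermitian_adjMat G).splits_charpoly

theorem HasCoeffs.energy_eq {n : ℕ} {G : SimpleGraph (Fin n)} {c : ℤ × ℤ × ℤ × ℤ}
    (h : HasCoeffs G c) : energy G = rootAbsSum (depressedQuintic c) := by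
  obtain ⟨k, hk⟩ := h.exists_eq
  rw [← hk, rootAbsSum_X_pow_mul (Matrix.charpoly_monic _).ne_zero, energy_eq_rootAbsSum]

theorem HasCoeffs.energy_ne {n : ℕ} {G H : SimpleGraph (Fin n)} {c c' : ℤ × ℤ × ℤ × ℤ}
    (h : HasCoeffs G c) (h' : HasCoeffs H c') (hb : BoundsSeparate c c' ∨ BoundsSeparate c' c) :
    energy G ≠ energy H := by
  rw [h.energy_eq, h'.energy_eq]
  rcases hb with hb | hb
  · exact hb.rootAbsSum_ne h.splits h'.splits
  · exact (hb.rootAbsSum_ne h'.splits h.splits).symm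

theorem hasCoeffs_two (G : SimpleGraph (Fin 2)) :
    HasCoeffs G (boolCoeffs (adjBool G 0 1) false false
      false false false
      false false false false) := by
  have hM : (adjMat G).charmatrix = !![
      X, -((adjBool G 0 1).toInt : ℝ[X]);
      -((adjBool G 0 1).toInt : ℝ[X]), X] := by
    ext u v : 1
    rw [charmatrix_adjMat_apply]
    fin_cases u <;> fin_cases v <;>
      simp [adjBool_comm G 1 0]
  refine ⟨3, ?_⟩
  rw [depressedQuintic_boolCoeffs, Matrix.charpoly, hM, det_symm_two]
  simp only [Bool.toInt_false, Int.cast_zero]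

theorem hasCoeffs_three (G : SimpleGraph (Fin 3)) :
    HasCoeffs G (boolCoeffs (adjBool G 0 1) (adjBool G 0 2) (adjBool G 1 2)
      false false false
      false false false false) := by
  have hM : (adjMat G).charmatrix = !![
      X, -((adjBool G 0 1).toInt : ℝ[X]),
        -((adjBool G 0 2).toInt : ℝ[X]);
      -((adjBool G 0 1).toInt : ℝ[X]), X,
        -((adjBool G 1 2).toInt : ℝ[X]);
      -((adjBool G 0 2).toInt : ℝ[X]), -((adjBool G 1 2).toInt : ℝ[X]),
        X] := by
    ext u v : 1
    rw [charmatrix_adjMat_apply]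
    fin_cases u <;> fin_cases v <;>
      simp [adjBool_comm G 1 0, adjBool_comm G 2 0, adjBool_comm G 2 1]
  refine ⟨2, ?_⟩
  rw [depressedQuintic_boolCoeffs, Matrix.charpoly, hM, det_symm_three]
  simp only [Bool.toInt_false, Int.cast_zero]

theorem hasCoeffs_four (G : SimpleGraph (Fin 4)) :
    HasCoeffs G (boolCoeffs (adjBool G 0 1) (adjBool G 0 2) (adjBool G 1 2)
      (adjBool G 0 3) (adjBool G 1 3) (adjBool G 2 3)
      false false false false) := by
  have hM : (adjMat G).charmatrix = !![
      X, -((adjBool G 0 1).toInt : ℝ[X]),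
        -((adjBool G 0 2).toInt : ℝ[X]), -((adjBool G 0 3).toInt : ℝ[X]);
      -((adjBool G 0 1).toInt : ℝ[X]), X,
        -((adjBool G 1 2).toInt : ℝ[X]), -((adjBool G 1 3).toInt : ℝ[X]);
      -((adjBool G 0 2).toInt : ℝ[X]), -((adjBool G 1 2).toInt : ℝ[X]),
        X, -((adjBool G 2 3).toInt : ℝ[X]);
      -((adjBool G 0 3).toInt : ℝ[X]), -((adjBool G 1 3).toInt : ℝ[X]),
        -((adjBool G 2 3).toInt : ℝ[X]), X] := by
    ext u v : 1
    rw [charmatrix_adjMat_apply]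
    fin_cases u <;> fin_cases v <;>
      simp [adjBool_comm G 1 0, adjBool_comm G 2 0, adjBool_comm G 3 0, adjBool_comm G 2 1,
        adjBool_comm G 3 1, adjBool_comm G 3 2]
  refine ⟨1, ?_⟩
  rw [depressedQuintic_boolCoeffs, Matrix.charpoly, hM, pow_one, det_symm_four]
  simp only [Bool.toInt_false, Int.cast_zero]

theorem hasCoeffs_five (G : SimpleGraph (Fin 5)) :
    HasCoeffs G (boolCoeffs (adjBool G 0 1) (adjBool G 0 2) (adjBool G 1 2)
      (adjBool G 0 3) (adjBool G 1 3) (adjBool G 2 3)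
      (adjBool G 0 4) (adjBool G 1 4) (adjBool G 2 4) (adjBool G 3 4)) := by
  have hM : (adjMat G).charmatrix = !![
      X, -((adjBool G 0 1).toInt : ℝ[X]),
        -((adjBool G 0 2).toInt : ℝ[X]), -((adjBool G 0 3).toInt : ℝ[X]),
        -((adjBool G 0 4).toInt : ℝ[X]);
      -((adjBool G 0 1).toInt : ℝ[X]), X,
        -((adjBool G 1 2).toInt : ℝ[X]), -((adjBool G 1 3).toInt : ℝ[X]),
        -((adjBool G 1 4).toInt : ℝ[X]);
      -((adjBool G 0 2).toInt : ℝ[X]), -((adjBool G 1 2).toInt : ℝ[X]),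
        X, -((adjBool G 2 3).toInt : ℝ[X]),
        -((adjBool G 2 4).toInt : ℝ[X]);
      -((adjBool G 0 3).toInt : ℝ[X]), -((adjBool G 1 3).toInt : ℝ[X]),
        -((adjBool G 2 3).toInt : ℝ[X]), X,
        -((adjBool G 3 4).toInt : ℝ[X]);
      -((adjBool G 0 4).toInt : ℝ[X]), -((adjBool G 1 4).toInt : ℝ[X]),
        -((adjBool G 2 4).toInt : ℝ[X]), -((adjBool G 3 4).toInt : ℝ[X]),
        X] := by
    ext u v : 1
    rw [charmatrix_adjMat_apply]
    fin_cases u <;> fin_cases v <;>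
      simp [adjBool_comm G 1 0, adjBool_comm G 2 0, adjBool_comm G 3 0, adjBool_comm G 4 0,
        adjBool_comm G 2 1, adjBool_comm G 3 1, adjBool_comm G 4 1, adjBool_comm G 3 2,
        adjBool_comm G 4 2, adjBool_comm G 4 3]
  refine ⟨0, ?_⟩
  rw [depressedQuintic_boolCoeffs, Matrix.charpoly, hM, pow_zero, one_mul, det_symm_five]

/-- The Boolean adjacency matrix on four vertices with the given entries above the diagonal. -/
def boolTableFour (a b c d e f : Bool) : Fin 4 → Fin 4 → Bool :=
  ![![false, a, b, d], ![a, false, c, e], ![b, c, false, f], ![d, e, f, false]]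

/-- The Boolean adjacency matrix on five vertices with the given entries above the diagonal. -/
def boolTableFive (a b c d e f g h i j : Bool) : Fin 5 → Fin 5 → Bool :=
  ![![false, a, b, d, g], ![a, false, c, e, h], ![b, c, false, f, i], ![d, e, f, false, j],
    ![g, h, i, j, false]]

theorem adjBool_eq_boolTableFour (G : SimpleGraph (Fin 4)) :
    adjBool G = boolTableFour (adjBool G 0 1) (adjBool G 0 2) (adjBool G 1 2)
      (adjBool G 0 3) (adjBool G 1 3) (adjBool G 2 3) := by
  funext u v
  fin_cases u <;> fin_cases v <;>
    simp [boolTableFour, adjBool_self, adjBool_comm G 1 0, adjBool_comm G 2 0, adjBool_comm G 3 0,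
      adjBool_comm G 2 1, adjBool_comm G 3 1, adjBool_comm G 3 2]

theorem adjBool_eq_boolTableFive (G : SimpleGraph (Fin 5)) :
    adjBool G = boolTableFive (adjBool G 0 1) (adjBool G 0 2) (adjBool G 1 2)
      (adjBool G 0 3) (adjBool G 1 3) (adjBool G 2 3)
      (adjBool G 0 4) (adjBool G 1 4) (adjBool G 2 4) (adjBool G 3 4) := by
  funext u v
  fin_cases u <;> fin_cases v <;>
    simp [boolTableFive, adjBool_self, adjBool_comm G 1 0, adjBool_comm G 2 0, adjBool_comm G 3 0,
      adjBool_comm G 4 0, adjBool_comm G 2 1, adjBool_comm G 3 1, adjBool_comm G 4 1,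
      adjBool_comm G 3 2, adjBool_comm G 4 2, adjBool_comm G 4 3]

theorem nonempty_iso_of_adjBool {n : ℕ} {G H : SimpleGraph (Fin n)} {σ : Fin n → Fin n}
    (hσ : σ.Injective) (h : ∀ u v, u ≠ v → adjBool H (σ u) (σ v) = adjBool G u v) :
    Nonempty (G ≃g H) := by
  refine ⟨⟨Equiv.ofBijective σ (Finite.injective_iff_bijective.1 hσ), ?_⟩⟩
  intro u v
  rcases eq_or_ne u v with rfl | huv
  · simp
  · simpa [adjBool] using h u v huv

theorem nonempty_iso_compl_of_adjBool {n : ℕ} {G : SimpleGraph (Fin n)} {σ : Fin n → Fin n}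
    (hσ : σ.Injective) (h : ∀ u v, u ≠ v → adjBool G (σ u) (σ v) = !adjBool G u v) :
    Nonempty (G ≃g Gᶜ) := by
  refine nonempty_iso_of_adjBool hσ fun u v huv => ?_
  rw [adjBool_compl G (hσ.ne huv), h u v huv, Bool.not_not]

/-- The `4`-cycles on four points, one from each pair of mutually inverse ones. -/
def fourCyclesFour : List (Fin 4 → Fin 4) := [![1, 2, 3, 0], ![1, 3, 0, 2], ![2, 3, 1, 0]]

/-- The `4`-cycles on five points, one from each pair of mutually inverse ones. -/
def fourCyclesFive : List (Fin 5 → Fin 5) :=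
  [![0, 2, 3, 4, 1], ![0, 2, 4, 1, 3], ![0, 3, 4, 2, 1], ![2, 1, 3, 4, 0],
    ![2, 1, 4, 0, 3], ![3, 1, 4, 2, 0], ![1, 3, 2, 4, 0], ![1, 4, 2, 0, 3],
    ![3, 4, 2, 1, 0], ![1, 2, 4, 3, 0], ![1, 4, 0, 3, 2], ![2, 4, 1, 3, 0],
    ![1, 2, 3, 0, 4], ![1, 3, 0, 2, 4], ![2, 3, 1, 0, 4]]

theorem injective_of_mem_fourCyclesFour : ∀ σ ∈ fourCyclesFour, σ.Injective := by
  decide +kernel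

theorem injective_of_mem_fourCyclesFive : ∀ σ ∈ fourCyclesFive, σ.Injective := by
  decide +kernel

theorem separate_or_antimorphism_five (a b c d e f g h i j : Bool) :
    (BoundsSeparate (boolCoeffs a b c d e f g h i j)
        (boolCoeffs (!a) (!b) (!c) (!d) (!e) (!f) (!g) (!h) (!i) (!j)) ∨
      BoundsSeparate (boolCoeffs (!a) (!b) (!c) (!d) (!e) (!f) (!g) (!h) (!i) (!j))
        (boolCoeffs a b c d e f g h i j)) ∨
    ∃ σ ∈ fourCyclesFive, ∀ u v, u ≠ v → boolTableFive a b c d e f g h i j (σ u) (σ v)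
      = !boolTableFive a b c d e f g h i j u v := by
  revert a b c d e f g h i j
  decide +kernel

/-- The adjacency matrix of the `4`-cycle `0, 1, 2, 3`. -/
def cycleTableFour : Fin 4 → Fin 4 → Bool := boolTableFour true false true true false true

theorem adjBool_cycleGraph_four : adjBool (SimpleGraph.cycleGraph 4) = cycleTableFour := by
  funext u v
  have h : (SimpleGraph.cycleGraph 4).Adj u v ↔ cycleTableFour u v = true := by
    revert u v
    decide
  simp [adjBool, h]

theorem separate_or_antimorphism_or_cycle_four (a b c d e f : Bool) :
    (BoundsSeparate (boolCoeffs a b c d e f false false false false)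
        (boolCoeffs (!a) (!b) (!c) (!d) (!e) (!f) false false false false) ∨
      BoundsSeparate (boolCoeffs (!a) (!b) (!c) (!d) (!e) (!f) false false false false)
        (boolCoeffs a b c d e f false false false false)) ∨
    (∃ σ ∈ fourCyclesFour, ∀ u v, u ≠ v → boolTableFour a b c d e f (σ u) (σ v)
      = !boolTableFour a b c d e f u v) ∨
    (∃ σ ∈ [![0, 1, 2, 3], ![0, 2, 1, 3], ![0, 1, 3, 2]], σ.Injective ∧
      ((∀ u v, u ≠ v → cycleTableFour (σ u) (σ v) = boolTableFour a b c d e f u v) ∨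
        ∀ u v, u ≠ v → cycleTableFour (σ u) (σ v) = !boolTableFour a b c d e f u v)) := by
  revert a b c d e f
  decide +kernel

theorem separate_three (a b c : Bool) :
    BoundsSeparate (boolCoeffs a b c false false false false false false false)
        (boolCoeffs (!a) (!b) (!c) false false false false false false false) ∨
      BoundsSeparate (boolCoeffs (!a) (!b) (!c) false false false false false false false)
        (boolCoeffs a b c false false false false false false false) := by
  revert a b c
  decide +kernel

theorem separate_two (a : Bool) :
    BoundsSeparate (boolCoeffs a false false false false false false false false false)
        (boolCoeffs (!a) false false false false false false false false false) ∨
      BoundsSeparate (boolCoeffs (!a) false false false false false false false false false)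
        (boolCoeffs a false false false false false false false false false) := by
  revert a
  decide +kernel

theorem energy_compl_ne_two (G : SimpleGraph (Fin 2)) : energy G ≠ energy Gᶜ := by
  have h := hasCoeffs_two Gᶜ
  rw [adjBool_compl G (by decide)] at h
  exact (hasCoeffs_two G).energy_ne h (separate_two _)

theorem energy_compl_ne_three (G : SimpleGraph (Fin 3)) : energy G ≠ energy Gᶜ := by
  have h := hasCoeffs_three Gᶜ
  iterate 3 rw [adjBool_compl G (by decide)] at h
  exact (hasCoeffs_three G).energy_ne h (separate_three _ _ _)

theorem nonempty_iso_of_energy_eq_four (G : SimpleGraph (Fin 4)) (hE : energy G = energy Gᶜ) :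
    Nonempty (G ≃g Gᶜ) ∨ Nonempty (G ≃g SimpleGraph.cycleGraph 4) ∨
      Nonempty (G ≃g (SimpleGraph.cycleGraph 4)ᶜ) := by
  have h := hasCoeffs_four Gᶜ
  iterate 6 rw [adjBool_compl G (by decide)] at h
  rcases separate_or_antimorphism_or_cycle_four (adjBool G 0 1) (adjBool G 0 2) (adjBool G 1 2)
    (adjBool G 0 3) (adjBool G 1 3) (adjBool G 2 3) with hb | ⟨σ, hσ, hb⟩ | ⟨σ, -, hσ, hb⟩
  · exact absurd hE ((hasCoeffs_four G).energy_ne h hb)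
  · rw [← adjBool_eq_boolTableFour] at hb
    exact Or.inl (nonempty_iso_compl_of_adjBool (injective_of_mem_fourCyclesFour σ hσ) hb)
  · rw [← adjBool_eq_boolTableFour, ← adjBool_cycleGraph_four] at hb
    refine Or.inr (hb.imp (nonempty_iso_of_adjBool hσ) fun hb => ?_)
    refine nonempty_iso_of_adjBool hσ fun u v huv => ?_
    rw [adjBool_compl _ (hσ.ne huv), hb u v huv, Bool.not_not]

theorem nonempty_iso_of_energy_eq_five (G : SimpleGraph (Fin 5)) (hE : energy G = energy Gᶜ) :
    Nonempty (G ≃g Gᶜ) := by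
  have h := hasCoeffs_five Gᶜ
  iterate 10 rw [adjBool_compl G (by decide)] at h
  rcases separate_or_antimorphism_five (adjBool G 0 1) (adjBool G 0 2) (adjBool G 1 2)
    (adjBool G 0 3) (adjBool G 1 3) (adjBool G 2 3) (adjBool G 0 4) (adjBool G 1 4)
    (adjBool G 2 4) (adjBool G 3 4) with hb | ⟨σ, hσ, hb⟩
  · exact absurd hE ((hasCoeffs_five G).energy_ne h hb)
  · rw [← adjBool_eq_boolTableFive] at hb
    exact nonempty_iso_compl_of_adjBool (injective_of_mem_fourCyclesFive σ hσ) hb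

/-- If a graph `G` on at most 5 vertices is not isomorphic to its complement and is
equienergetic with its complement, then `G` has exactly 4 vertices and is isomorphic to the
4-cycle `C₄` or to its complement `K₂ ∪ K₂`. In particular, `(C₄, C₄ᶜ)` is, up to isomorphism,
the unique pair of complementary equienergetic graphs of order at most 5. -/
theorem complementary_equienergetic_order_le_five {V : Type*} [Fintype V]
    (G : SimpleGraph V) (hcard : Fintype.card V ≤ 5)
    (hns : ¬ Nonempty (G ≃g Gᶜ)) (hE : energy G = energy Gᶜ) :
    Fintype.card V = 4 ∧
      (Nonempty (G ≃g SimpleGraph.cycleGraph 4) ∨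
        Nonempty (G ≃g (SimpleGraph.cycleGraph 4)ᶜ)) := by
  obtain ⟨n, hn⟩ : ∃ n, Fintype.card V = n := ⟨_, rfl⟩
  obtain ⟨H, ⟨φ⟩⟩ : ∃ H : SimpleGraph (Fin n), Nonempty (G ≃g H) :=
    ⟨_, ⟨SimpleGraph.Iso.map (Fintype.equivFinOfCardEq hn) G⟩⟩
  have hns' : ¬ Nonempty (H ≃g Hᶜ) := fun ⟨ψ⟩ =>
    hns ⟨(φ.trans ψ).trans (complIso φ).symm⟩
  have hE' : energy H = energy Hᶜ := by
    rw [← energy_congr φ, hE, energy_congr (complIso φ)]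
  rw [hn] at hcard ⊢
  interval_cases n
  · exact absurd ⟨Subsingleton.elim H Hᶜ ▸ SimpleGraph.Iso.refl⟩ hns'
  · exact absurd ⟨Subsingleton.elim H Hᶜ ▸ SimpleGraph.Iso.refl⟩ hns'
  · exact absurd hE' (energy_compl_ne_two H)
  · exact absurd hE' (energy_compl_ne_three H)
  · exact ⟨rfl, ((nonempty_iso_of_energy_eq_four H hE').resolve_left hns').imp
      (fun ⟨ψ⟩ => ⟨φ.trans ψ⟩) fun ⟨ψ⟩ => ⟨φ.trans ψ⟩⟩
  · exact absurd (nonempty_iso_of_energy_eq_five H hE') hns'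
end

section
/- There exists a simple graph D on 6 vertices such that the multiset of eigenvalues of D is {3, 1, 0, 0, -2, -2}, the multiset of eigenvalues of its complement D̄ is {2, 1, 1, -1, -1, -2}, D is not isomorphic to D̄, D and D̄ are not cospectral, and E(D) = E(D̄) = 8. -/
open Polynomial

/-- If an integer matrix `M` is diagonalized by a matrix `P` that is invertible up to the scalar
`k`, the roots of the characteristic polynomial of `M` over `ℝ` are the diagonal entries. -/
theorem roots_charpoly_map_of_mul_eq_mul_diagonal {n : Type*} [Fintype n] [DecidableEq n]
    {M P Q : Matrix n n ℤ} {d : n → ℤ} {k : ℤ} (hk : k ≠ 0)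
    (hP : M * P = P * Matrix.diagonal d) (hPQ : P * Q = k • 1) :
    (M.map (Int.cast : ℤ → ℝ)).charpoly.roots =
      Finset.univ.val.map (fun i => (d i : ℝ)) := by
  let f : ℤ →+* ℝ := Int.castRingHom ℝ
  have hk' : (k : ℝ) ≠ 0 := Int.cast_ne_zero.mpr hk
  have hP' : f.mapMatrix M * f.mapMatrix P =
      f.mapMatrix P * Matrix.diagonal (fun i => (d i : ℝ)) := by
    rw [← map_mul, hP, map_mul]
    congr 1
    ext i j
    by_cases h : i = j <;> simp [f, h]
  have hPQ' : f.mapMatrix P * ((k : ℝ)⁻¹ • f.mapMatrix Q) = 1 := by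
    rw [mul_smul_comm, ← map_mul, hPQ, map_zsmul, map_one, ← Int.cast_smul_eq_zsmul ℝ, smul_smul,
      inv_mul_cancel₀ hk', one_smul]
  have hM : f.mapMatrix M = f.mapMatrix P * Matrix.diagonal (fun i => (d i : ℝ)) *
      ((k : ℝ)⁻¹ • f.mapMatrix Q) := by
    rw [← hP', mul_assoc, hPQ', mul_one]
  change (f.mapMatrix M).charpoly.roots = _
  rw [hM, Matrix.charpoly_mul_comm, ← mul_assoc, mul_eq_one_comm.mp hPQ', one_mul,
    Matrix.charpoly_diagonal]
  rw [← roots_multiset_prod_X_sub_C (Finset.univ.val.map fun i => (d i : ℝ)), Multiset.map_map]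
  rfl

theorem adjMat_eq_map_adjMatrix {V : Type*} [Finite V] (G : SimpleGraph V)
    [DecidableRel G.Adj] : adjMat G = (G.adjMatrix ℤ).map (Int.cast : ℤ → ℝ) := by
  ext i j
  by_cases h : G.Adj i j <;> simp [adjMat, SimpleGraph.adjMatrix_apply, h]

theorem energy_eq_sum_abs_roots {V : Type*} [Fintype V] [DecidableEq V] (G : SimpleGraph V) :
    energy G = ((adjMat G).charpoly.roots.map (fun x => |x|)).sum := by
  unfold energy
  congr!

/-- A common eigenbasis of the 6-cycle and its complement, as columns. -/
def hexagonEigenbasis : Matrix (Fin 6) (Fin 6) ℤ :=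
  !![1,  1,  1,  0,  1,  0;
     1, -1,  1,  1, -1,  1;
     1,  1,  0,  1,  0, -1;
     1, -1, -1,  0,  1,  0;
     1,  1, -1, -1, -1,  1;
     1, -1,  0, -1,  0, -1]

/-- Six times the inverse of `hexagonEigenbasis`. -/
def hexagonDualBasis : Matrix (Fin 6) (Fin 6) ℤ :=
  !![ 1,  1,  1,  1,  1,  1;
      1, -1,  1, -1,  1, -1;
      2,  1, -1, -2, -1,  1;
     -1,  1,  2,  1, -1, -2;
      2, -1, -1,  2, -1, -1;
      1,  1, -2,  1,  1, -2]

theorem hexagonEigenbasis_mul_dual : hexagonEigenbasis * hexagonDualBasis = (6 : ℤ) • 1 := by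
  decide +kernel

theorem roots_charpoly_hexagon :
    (adjMat (SimpleGraph.cycleGraph 6)).charpoly.roots =
      ({2, 1, 1, -1, -1, -2} : Multiset ℝ) := by
  have h : (SimpleGraph.cycleGraph 6).adjMatrix ℤ * hexagonEigenbasis =
      hexagonEigenbasis * Matrix.diagonal ![2, -2, 1, 1, -1, -1] := by decide +kernel
  rw [adjMat_eq_map_adjMatrix,
    roots_charpoly_map_of_mul_eq_mul_diagonal (by decide) h hexagonEigenbasis_mul_dual]
  have e : Finset.univ.val.map ![2, -2, 1, 1, -1, -1] =
      ({2, 1, 1, -1, -1, -2} : Multiset ℤ) := by decide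
  simpa [Multiset.map_map] using congrArg (Multiset.map (Int.cast : ℤ → ℝ)) e

theorem roots_charpoly_compl_hexagon :
    (adjMat (SimpleGraph.cycleGraph 6)ᶜ).charpoly.roots =
      ({3, 1, 0, 0, -2, -2} : Multiset ℝ) := by
  have h : (SimpleGraph.cycleGraph 6)ᶜ.adjMatrix ℤ * hexagonEigenbasis =
      hexagonEigenbasis * Matrix.diagonal ![3, 1, -2, -2, 0, 0] := by decide +kernel
  rw [adjMat_eq_map_adjMatrix,
    roots_charpoly_map_of_mul_eq_mul_diagonal (by decide) h hexagonEigenbasis_mul_dual]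
  have e : Finset.univ.val.map ![3, 1, -2, -2, 0, 0] =
      ({3, 1, 0, 0, -2, -2} : Multiset ℤ) := by decide
  simpa [Multiset.map_map] using congrArg (Multiset.map (Int.cast : ℤ → ℝ)) e

theorem not_nonempty_compl_hexagon_iso :
    ¬ Nonempty ((SimpleGraph.cycleGraph 6)ᶜ ≃g SimpleGraph.cycleGraph 6) := by
  rintro ⟨e⟩
  have triangle_free : ∀ a b c : Fin 6, (SimpleGraph.cycleGraph 6).Adj a b →
      (SimpleGraph.cycleGraph 6).Adj b c → ¬ (SimpleGraph.cycleGraph 6).Adj a c := by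
    decide +kernel
  exact triangle_free (e 0) (e 2) (e 4) (e.map_adj_iff.mpr (by decide))
    (e.map_adj_iff.mpr (by decide)) (e.map_adj_iff.mpr (by decide))

/-- There is a graph `D` on 6 vertices whose spectrum is `{3, 1, 0, 0, -2, -2}`, whose
complement has spectrum `{2, 1, 1, -1, -1, -2}`, such that `D` is not isomorphic to `Dᶜ`,
`D` and `Dᶜ` are not cospectral, and `E(D) = E(Dᶜ) = 8`. -/
theorem exists_complementary_equienergetic_six :
    ∃ D : SimpleGraph (Fin 6),
      (adjMat D).charpoly.roots = ({3, 1, 0, 0, -2, -2} : Multiset ℝ) ∧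
      (adjMat Dᶜ).charpoly.roots = ({2, 1, 1, -1, -1, -2} : Multiset ℝ) ∧
      ¬ Nonempty (D ≃g Dᶜ) ∧
      (adjMat D).charpoly ≠ (adjMat Dᶜ).charpoly ∧
      energy D = 8 ∧ energy Dᶜ = 8 := by
  refine ⟨(SimpleGraph.cycleGraph 6)ᶜ, ?_⟩
  rw [compl_compl]
  refine ⟨roots_charpoly_compl_hexagon, roots_charpoly_hexagon, not_nonempty_compl_hexagon_iso,
    fun h => ?_, ?_, ?_⟩
  · have hr := congrArg Polynomial.roots h
    rw [roots_charpoly_compl_hexagon, roots_charpoly_hexagon] at hr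
    have h3 : (3 : ℝ) ∈ ({2, 1, 1, -1, -1, -2} : Multiset ℝ) := hr ▸ by simp
    norm_num at h3
  · rw [energy_eq_sum_abs_roots, roots_charpoly_compl_hexagon]
    norm_num
  · rw [energy_eq_sum_abs_roots, roots_charpoly_hexagon]
    norm_num
end

section
/- There is exactly one pair of complementary equienergetic graphs of order 6: there exists a 6-vertex graph D with D not isomorphic to D̄ and E(D) = E(D̄), such that every 6-vertex graph G satisfying G not isomorphic to Ḡ and E(G) = E(Ḡ) is isomorphic to D or to D̄. -/
open Polynomial

namespace GraphEnergy

/-! ### Graphs on six vertices as bit masks -/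

/-- The `k`-th binary digit of `m`. -/
def bit (m k : ℕ) : ℕ := (m >>> k) % 2

/-- The number with the given binary digits, least significant digit first. -/
def ofBits (l : List ℕ) : ℕ := l.foldr (fun b acc => b + 2 * acc) 0

/-- The position of the pair `{i, j}` in the bit mask of a graph. -/
def edgeIndex (i j : ℕ) : ℕ := if i < j then j * (j - 1) / 2 + i else i * (i - 1) / 2 + j

/-- The pairs of vertices in the order given by `edgeIndex`. -/
def edgePairs : List (Fin 6 × Fin 6) :=
  [(0, 1), (0, 2), (1, 2), (0, 3), (1, 3), (2, 3), (0, 4), (1, 4), (2, 4), (3, 4),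
    (0, 5), (1, 5), (2, 5), (3, 5), (4, 5)]

lemma edgeIndex_comm (i j : ℕ) : edgeIndex i j = edgeIndex j i := by
  unfold edgeIndex
  rcases lt_trichotomy i j with h | rfl | h
  · rw [if_pos h, if_neg h.not_gt]
  · rfl
  · rw [if_neg h.not_gt, if_pos h]

/-- The graph encoded by a bit mask. -/
def maskGraph (m : ℕ) : SimpleGraph (Fin 6) where
  Adj i j := i ≠ j ∧ bit m (edgeIndex i j) = 1
  symm := ⟨fun i j h => ⟨h.1.symm, edgeIndex_comm i j ▸ h.2⟩⟩
  loopless := ⟨fun _ h => h.1 rfl⟩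

instance (m : ℕ) : DecidableRel (maskGraph m).Adj :=
  fun i j => inferInstanceAs (Decidable (i ≠ j ∧ bit m (edgeIndex i j) = 1))

lemma maskGraph_adj {m : ℕ} {i j : Fin 6} :
    (maskGraph m).Adj i j ↔ i ≠ j ∧ bit m (edgeIndex i j) = 1 := Iff.rfl

lemma bit_lt_two (m k : ℕ) : bit m k < 2 := Nat.mod_lt _ two_pos

lemma lt_two_of_mem_map_bit {m : ℕ} {l : List ℕ} : ∀ b ∈ l.map (bit m), b < 2 := by
  simp only [List.mem_map]
  rintro _ ⟨k, -, rfl⟩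
  exact bit_lt_two m k

lemma bit_ofBits {l : List ℕ} (hl : ∀ b ∈ l, b < 2) (k : ℕ) : bit (ofBits l) k = l.getD k 0 := by
  induction l generalizing k with
  | nil => simp [ofBits, bit]
  | cons b l ih =>
    have hb : b < 2 := hl b (by simp)
    have hcons : ofBits (b :: l) = b + 2 * ofBits l := rfl
    cases k with
    | zero => simp only [bit, hcons, List.getD_cons_zero, Nat.shiftRight_zero]; omega
    | succ k =>
      rw [List.getD_cons_succ, ← ih (fun c hc => hl c (by simp [hc]))]
      have : (b + 2 * ofBits l) / 2 = ofBits l := by omega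
      rw [bit, hcons, Nat.shiftRight_succ_inside, this, bit]

lemma ofBits_lt {l : List ℕ} (hl : ∀ b ∈ l, b < 2) : ofBits l < 2 ^ l.length := by
  induction l with
  | nil => simp [ofBits]
  | cons b l ih =>
    have hb : b < 2 := hl b (by simp)
    have := ih fun c hc => hl c (by simp [hc])
    have hcons : ofBits (b :: l) = b + 2 * ofBits l := rfl
    rw [hcons, List.length_cons, pow_succ]
    omega

lemma ofBits_drop {l : List ℕ} (hl : ∀ b ∈ l, b < 2) (n : ℕ) :
    ofBits (l.drop n) = ofBits l / 2 ^ n := by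
  induction n generalizing l with
  | zero => simp
  | succ n ih =>
    cases l with
    | nil => simp [ofBits]
    | cons b l =>
      have hb : b < 2 := hl b (by simp)
      have hcons : ofBits (b :: l) = b + 2 * ofBits l := rfl
      have : (b + 2 * ofBits l) / 2 = ofBits l := by omega
      rw [List.drop_succ_cons, ih fun c hc => hl c (by simp [hc]), hcons, pow_succ',
        ← Nat.div_div_eq_div_mul, this]

lemma bit_add (m n k : ℕ) : bit m (n + k) = bit (m / 2 ^ n) k := by
  simp only [bit, Nat.shiftRight_eq_div_pow, pow_add, Nat.div_div_eq_div_mul]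

/-- The number whose binary digits are the digits of `m` at the given positions. -/
def selectBits (m : ℕ) (l : List ℕ) : ℕ := ofBits (l.map (bit m))

lemma selectBits_lt (m : ℕ) (l : List ℕ) : selectBits m l < 2 ^ l.length := by
  simpa [selectBits] using ofBits_lt (l := l.map (bit m)) lt_two_of_mem_map_bit

/-- The rearrangement of edge positions induced by a map on vertices. -/
def edgePerm (σ : Fin 6 → Fin 6) : List ℕ := edgePairs.map fun p => edgeIndex (σ p.1) (σ p.2)

lemma getD_map_edgePairs (f : Fin 6 → Fin 6 → ℕ) (hf : ∀ i j, f i j = f j i) {i j : Fin 6}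
    (hij : i ≠ j) : (edgePairs.map fun p => f p.1 p.2).getD (edgeIndex i j) 0 = f i j := by
  fin_cases i <;> fin_cases j <;>
    first | exact absurd rfl hij | rfl | exact hf _ _

lemma maskGraph_selectBits_adj (m : ℕ) {σ : Fin 6 → Fin 6} (hσ : σ.Injective) (i j : Fin 6) :
    (maskGraph (selectBits m (edgePerm σ))).Adj i j ↔ (maskGraph m).Adj (σ i) (σ j) := by
  simp only [maskGraph_adj, hσ.ne_iff]
  refine and_congr_right fun hij => ?_
  rw [selectBits, bit_ofBits lt_two_of_mem_map_bit, edgePerm, List.map_map]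
  have := getD_map_edgePairs (fun i j => bit m (edgeIndex (σ i) (σ j)))
    (fun i j => by rw [edgeIndex_comm]) hij
  simp only [Function.comp_def, this]

/-- Permuting the vertices of an encoded graph. -/
def selectBitsIso (m : ℕ) (σ : Equiv.Perm (Fin 6)) :
    maskGraph (selectBits m (edgePerm σ)) ≃g maskGraph m where
  toEquiv := σ
  map_rel_iff' := (maskGraph_selectBits_adj m σ.injective _ _).symm

lemma exists_maskGraph_eq (G : SimpleGraph (Fin 6)) : ∃ m < 2 ^ 15, maskGraph m = G := by
  classical
  let f : Fin 6 → Fin 6 → ℕ := fun i j => if G.Adj i j then 1 else 0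
  have hf : ∀ b ∈ edgePairs.map fun p => f p.1 p.2, b < 2 := by
    simp only [List.mem_map, forall_exists_index, and_imp, f]
    rintro _ p - rfl
    split_ifs <;> simp
  refine ⟨ofBits (edgePairs.map fun p => f p.1 p.2), ofBits_lt hf, ?_⟩
  ext i j
  rw [maskGraph_adj, bit_ofBits hf]
  by_cases hij : i = j
  · simp [hij]
  · rw [getD_map_edgePairs f (by simp [f, G.adj_comm]) hij]
    simp [hij, f]

lemma compl_maskGraph {m : ℕ} (hm : m < 2 ^ 15) : (maskGraph m)ᶜ = maskGraph (32767 - m) := by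
  have h : ∀ k < 15, bit (32767 - m) k = 1 ↔ bit m k ≠ 1 := by
    intro k hk
    have hbit : ∀ a, bit a k = 1 ↔ a.testBit k = true := by
      intro a
      rw [Nat.testBit_eq_decide_div_mod_eq, bit, Nat.shiftRight_eq_div_pow, decide_eq_true_iff]
    rw [Ne, hbit, hbit, show 32767 - m = 2 ^ 15 - (m + 1) by omega,
      Nat.testBit_two_pow_sub_succ hm]
    simp [hk]
  have hlt : ∀ i j : Fin 6, edgeIndex i j < 15 ∨ i = j := by decide
  ext i j
  rw [SimpleGraph.compl_adj, maskGraph_adj, maskGraph_adj]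
  by_cases hij : i = j
  · simp [hij]
  · simp [hij, h _ ((hlt i j).resolve_right hij)]

/-- The rearrangements of edge positions induced by transpositions of two vertices. -/
def swaps : List (List ℕ) := edgePairs.map fun p => edgePerm (Equiv.swap p.1 p.2)

/-- The actions of transpositions on the edge positions from `n` on, where defined. -/
def swapsAbove (n : ℕ) : List (List ℕ) :=
  ((swaps.map (List.drop n)).filter fun l => l.all n.ble).map fun l => l.map (· - n)

/-- Whether no transposition decreases the number formed by the digits of a mask from position
`n` on. -/
def leadingMinimal (n m : ℕ) : Bool := (swapsAbove n).all fun l => m.ble (selectBits m l)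

/-- Whether `P` holds for all masks which start with the digits `m`, have `n` further digits and
do not decrease under transpositions. -/
def forallMinimal (P : ℕ → Bool) : ℕ → ℕ → Bool
  | 0, m => !leadingMinimal 0 m || P m
  | n + 1, m => !leadingMinimal (n + 1) m ||
    (forallMinimal P n (2 * m) && forallMinimal P n (2 * m + 1))

lemma leadingMinimal_of_minimal {M : ℕ} (hM : ∀ l ∈ swaps, M ≤ selectBits M l) (n : ℕ) :
    leadingMinimal n (M / 2 ^ n) = true := by
  simp only [leadingMinimal, swapsAbove, List.all_eq_true, List.mem_map, List.mem_filter,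
    Nat.ble_eq]
  rintro _ ⟨_, ⟨⟨l, hl, rfl⟩, hn⟩, rfl⟩
  have h : selectBits (M / 2 ^ n) ((l.drop n).map (· - n)) = selectBits M l / 2 ^ n := by
    rw [selectBits, selectBits, ← ofBits_drop lt_two_of_mem_map_bit, List.map_map,
      ← List.map_drop]
    congr 1
    refine List.map_congr_left fun k hk => ?_
    rw [Function.comp_apply, ← bit_add, Nat.add_sub_cancel' (hn k hk)]
  rw [h]
  exact Nat.div_le_div_right (hM l hl)

lemma forallMinimal_spec {P : ℕ → Bool} {M : ℕ} (hM : ∀ l ∈ swaps, M ≤ selectBits M l) {n : ℕ}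
    (h : forallMinimal P n (M / 2 ^ n) = true) : P M = true := by
  induction n with
  | zero =>
    have := leadingMinimal_of_minimal hM 0
    simp_all [forallMinimal]
  | succ n ih =>
    rw [forallMinimal, leadingMinimal_of_minimal hM, Bool.not_true, Bool.false_or,
      Bool.and_eq_true, pow_succ, ← Nat.div_div_eq_div_mul] at h
    apply ih
    rcases Nat.mod_two_eq_zero_or_one (M / 2 ^ n) with h2 | h2
    · rw [show M / 2 ^ n = 2 * (M / 2 ^ n / 2) by omega]
      exact h.1
    · rw [show M / 2 ^ n = 2 * (M / 2 ^ n / 2) + 1 by omega]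
      exact h.2

/-- Whether no transposition followed by complementation decreases a mask. -/
def complMinimal (m : ℕ) : Bool := swaps.all fun l => (m + selectBits m l).ble 32767

/-- Up to isomorphism and complementation, every graph is encoded by a mask which does not
decrease under transpositions and complementation. -/
lemma exists_minimal_mask (G : SimpleGraph (Fin 6)) :
    ∃ m < 2 ^ 14, (Nonempty (G ≃g maskGraph m) ∨ Nonempty (Gᶜ ≃g maskGraph m)) ∧
      (∀ l ∈ swaps, m ≤ selectBits m l) ∧ complMinimal m = true := by
  let S : Set ℕ := {m | m < 2 ^ 15 ∧
    (Nonempty (G ≃g maskGraph m) ∨ Nonempty (Gᶜ ≃g maskGraph m))}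
  have hcompl : ∀ m ∈ S, 32767 - m ∈ S := by
    rintro m ⟨hm, h⟩
    refine ⟨by omega, ?_⟩
    rw [← compl_maskGraph hm]
    rcases h with ⟨⟨φ⟩⟩ | ⟨⟨φ⟩⟩
    · exact .inr ⟨⟨φ.toEquiv, by simp [SimpleGraph.compl_adj, φ.map_adj_iff]⟩⟩
    · refine .inl ⟨⟨φ.toEquiv, fun {i j} => ?_⟩⟩
      have h1 : (maskGraph m).Adj (φ i) (φ j) ↔ _ := φ.map_adj_iff
      simp only [SimpleGraph.compl_adj, RelIso.coe_fn_toEquiv, h1, φ.injective.ne_iff]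
      have := G.ne_of_adj (a := i) (b := j)
      tauto
  have hswap : ∀ m ∈ S, ∀ l ∈ swaps, selectBits m l ∈ S := by
    rintro m ⟨hm, h⟩ l hl
    obtain ⟨p, -, rfl⟩ := List.mem_map.1 hl
    refine ⟨selectBits_lt _ _, ?_⟩
    let ψ := (selectBitsIso m (Equiv.swap p.1 p.2)).symm
    exact h.imp (fun ⟨φ⟩ => ⟨φ.trans ψ⟩) (fun ⟨φ⟩ => ⟨φ.trans ψ⟩)
  have hne : S.Nonempty := by
    obtain ⟨m, hm, rfl⟩ := exists_maskGraph_eq G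
    exact ⟨m, hm, .inl ⟨.refl⟩⟩
  have hmem := Nat.sInf_mem hne
  have hmin : ∀ k ∈ S, sInf S ≤ k := fun k hk => Nat.sInf_le hk
  refine ⟨sInf S, ?_, hmem.2, fun l hl => hmin _ (hswap _ hmem l hl), ?_⟩
  · have := hmin _ (hcompl _ hmem)
    omega
  · simp only [complMinimal, List.all_eq_true, Nat.ble_eq]
    intro l hl
    have h1 := hswap _ hmem l hl
    have h2 := hmin _ (hcompl _ h1)
    have h3 := h1.1
    omega

/-! ### Eigenvalues and power sums -/

lemma exists_eigenvalues {n : ℕ} (G : SimpleGraph (Fin n)) :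
    ∃ x : Fin n → ℝ, Antitone x ∧ energy G = ∑ i, |x i| ∧
      ∀ k, ∑ i, x i ^ k = (adjMat G ^ k).trace := by
  have hA : (adjMat G).IsHermitian := by
    ext i j
    by_cases hij : G.Adj i j <;>
      simp [adjMat, Matrix.conjTranspose_apply, SimpleGraph.adjMatrix_apply, G.adj_comm j i, hij]
  have hcard : Fintype.card (Fin n) = n := Fintype.card_fin n
  let e := finCongr hcard
  have hroots : (adjMat G).charpoly.roots = Finset.univ.val.map (hA.eigenvalues₀ ∘ e.symm) := by
    rw [hA.roots_charpoly_eq_eigenvalues₀, ← Finset.map_univ_equiv e.symm, Finset.map_val,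
      Multiset.map_map]
    rfl
  refine ⟨hA.eigenvalues₀ ∘ e.symm, fun i j hij => hA.eigenvalues₀_antitone hij, ?_, fun k => ?_⟩
  · have : energy G = ((adjMat G).charpoly.roots.map fun x => |x|).sum := by
      unfold energy
      congr!
    rw [this, hroots, Multiset.map_map]
    rfl
  · have h1 : ∑ i, (hA.eigenvalues₀ ∘ e.symm) i ^ k = ∑ i, hA.eigenvalues i ^ k := by
      have := congrArg (fun s => (s.map (· ^ k)).sum)
        (hroots.symm.trans hA.roots_charpoly_eq_eigenvalues)
      simp only [Multiset.map_map] at this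
      exact this
    rw [h1]
    conv_rhs => rw [hA.spectral_theorem, ← map_pow, Unitary.conjStarAlgAut_apply,
      Matrix.trace_mul_cycle, Matrix.diagonal_pow]
    simp [Matrix.trace]

/-- The power sums of degree two to six of a spectrum with vanishing sum. -/
structure PowerSums where
  (p2 p3 p4 p5 p6 : ℕ)

/-- The numbers `x i` have sum zero and the given power sums. -/
structure PowerSums.Represents (p : PowerSums) (x : Fin 6 → ℝ) : Prop where
  sum : ∑ i, x i = 0
  sum2 : ∑ i, x i ^ 2 = p.p2
  sum3 : ∑ i, x i ^ 3 = p.p3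
  sum4 : ∑ i, x i ^ 4 = p.p4
  sum5 : ∑ i, x i ^ 5 = p.p5
  sum6 : ∑ i, x i ^ 6 = p.p6

/-- The power sums after multiplication of the spectrum by `K`. -/
def PowerSums.scale (p : PowerSums) (K : ℕ) : PowerSums :=
  ⟨K * K * p.p2, K * K * K * p.p3, K * K * K * K * p.p4, K * K * K * K * K * p.p5,
    K * K * K * K * K * K * p.p6⟩

lemma PowerSums.Represents.scale {p : PowerSums} {x : Fin 6 → ℝ} (h : p.Represents x) (K : ℕ) :
    (p.scale K).Represents fun i => K * x i := by
  constructor <;> simp only [mul_pow, ← Finset.mul_sum, h.sum, h.sum2, h.sum3, h.sum4, h.sum5,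
    h.sum6, PowerSums.scale] <;> push_cast <;> ring

lemma prod_sub_eq_of_powerSums {R : Type*} [CommRing R] (x : Fin 6 → R) (hx : ∑ i, x i = 0)
    (t : R) :
    720 * ∏ i, (t - x i) = 720 * t ^ 6 - 360 * (∑ i, x i ^ 2) * t ^ 4
      - 240 * (∑ i, x i ^ 3) * t ^ 3
      + (90 * (∑ i, x i ^ 2) ^ 2 - 180 * ∑ i, x i ^ 4) * t ^ 2
      + (120 * (∑ i, x i ^ 2) * (∑ i, x i ^ 3) - 144 * ∑ i, x i ^ 5) * t
      + (90 * (∑ i, x i ^ 2) * (∑ i, x i ^ 4) + 40 * (∑ i, x i ^ 3) ^ 2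
        - 120 * (∑ i, x i ^ 6) - 15 * (∑ i, x i ^ 2) ^ 3) := by
  simp only [Fin.sum_univ_six, Fin.prod_univ_six] at hx ⊢
  rw [eq_neg_of_add_eq_zero_right hx]
  ring

/-- Vectors of natural numbers of length six. -/
structure Vec6 where
  (x0 x1 x2 x3 x4 x5 : ℕ)

/-- Six by six matrices of natural numbers, in a form suited to kernel computation. -/
structure Mat6 where
  (r0 r1 r2 r3 r4 r5 : Vec6)

/-- The dot product. -/
def Vec6.dot (u v : Vec6) : ℕ :=
  u.x0 * v.x0 + u.x1 * v.x1 + u.x2 * v.x2 + u.x3 * v.x3 + u.x4 * v.x4 + u.x5 * v.x5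

/-- The product of `B` with `u`. -/
def Vec6.mulT (u : Vec6) (B : Mat6) : Vec6 :=
  ⟨u.dot B.r0, u.dot B.r1, u.dot B.r2, u.dot B.r3, u.dot B.r4, u.dot B.r5⟩

/-- The product of `A` with the transpose of `B`. -/
def Mat6.mulT (A B : Mat6) : Mat6 :=
  ⟨A.r0.mulT B, A.r1.mulT B, A.r2.mulT B, A.r3.mulT B, A.r4.mulT B, A.r5.mulT B⟩

/-- The sum of the products of corresponding entries. -/
def Mat6.dot (A B : Mat6) : ℕ :=
  A.r0.dot B.r0 + A.r1.dot B.r1 + A.r2.dot B.r2 + A.r3.dot B.r3 + A.r4.dot B.r4 + A.r5.dot B.r5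

/-- The vector with the given entries. -/
def Vec6.ofFun (v : Fin 6 → ℕ) : Vec6 := ⟨v 0, v 1, v 2, v 3, v 4, v 5⟩

/-- The conversion from Mathlib's matrices. -/
def Mat6.ofMatrix (M : Matrix (Fin 6) (Fin 6) ℕ) : Mat6 :=
  ⟨.ofFun (M 0), .ofFun (M 1), .ofFun (M 2), .ofFun (M 3), .ofFun (M 4), .ofFun (M 5)⟩

lemma Mat6.mulT_ofMatrix (M N : Matrix (Fin 6) (Fin 6) ℕ) :
    (ofMatrix M).mulT (ofMatrix N) = ofMatrix (M * N.transpose) := by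
  simp [mulT, ofMatrix, Vec6.mulT, Vec6.dot, Vec6.ofFun, Matrix.mul_apply, Fin.sum_univ_six]

lemma Mat6.dot_ofMatrix (M N : Matrix (Fin 6) (Fin 6) ℕ) :
    (ofMatrix M).dot (ofMatrix N) = (M * N.transpose).trace := by
  simp [dot, ofMatrix, Vec6.dot, Vec6.ofFun, Matrix.mul_apply, Fin.sum_univ_six, Matrix.trace]

/-- The adjacency matrix of `maskGraph m`. -/
def maskMatrix (m : ℕ) : Mat6 :=
  ⟨⟨0, bit m 0, bit m 1, bit m 3, bit m 6, bit m 10⟩,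
   ⟨bit m 0, 0, bit m 2, bit m 4, bit m 7, bit m 11⟩,
   ⟨bit m 1, bit m 2, 0, bit m 5, bit m 8, bit m 12⟩,
   ⟨bit m 3, bit m 4, bit m 5, 0, bit m 9, bit m 13⟩,
   ⟨bit m 6, bit m 7, bit m 8, bit m 9, 0, bit m 14⟩,
   ⟨bit m 10, bit m 11, bit m 12, bit m 13, bit m 14, 0⟩⟩

lemma maskMatrix_eq (m : ℕ) : maskMatrix m = .ofMatrix ((maskGraph m).adjMatrix ℕ) := by
  have h : ∀ k, (if bit m k = 1 then 1 else 0) = bit m k := fun k => by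
    have := bit_lt_two m k
    split_ifs <;> omega
  simp [maskMatrix, Mat6.ofMatrix, Vec6.ofFun, SimpleGraph.adjMatrix_apply, maskGraph_adj,
    edgeIndex, h]

/-- The power sums of the spectrum of a symmetric matrix. -/
def Mat6.powerSums (A : Mat6) : PowerSums :=
  let B := A.mulT A
  let C := B.mulT A
  ⟨A.dot A, A.dot B, B.dot B, B.dot C, C.dot C⟩

lemma represents_of_maskGraph {m : ℕ} {x : Fin 6 → ℝ}
    (hx : ∀ k, ∑ i, x i ^ k = (adjMat (maskGraph m) ^ k).trace) :
    (maskMatrix m).powerSums.Represents x := by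
  set A := (maskGraph m).adjMatrix ℕ with hA
  have hT : A.transpose = A := SimpleGraph.transpose_adjMatrix _
  have hcast : adjMat (maskGraph m) = A.map (Nat.castRingHom ℝ) := by
    ext i j
    simp [adjMat, hA, SimpleGraph.adjMatrix_apply]
  have hpow : ∀ k, ∑ i, x i ^ k = ((A ^ k).trace : ℕ) := fun k => by
    rw [hx, hcast, ← Matrix.map_pow]
    simp [Matrix.trace]
  have hp : (maskMatrix m).powerSums =
      ⟨(A ^ 2).trace, (A ^ 3).trace, (A ^ 4).trace, (A ^ 5).trace, (A ^ 6).trace⟩ := by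
    rw [maskMatrix_eq]
    simp only [Mat6.powerSums, Mat6.mulT_ofMatrix, Mat6.dot_ofMatrix, Matrix.transpose_mul, ← hA,
      hT, pow_succ, pow_zero, one_mul, mul_assoc]
  rw [hp]
  refine ⟨?_, hpow 2, hpow 3, hpow 4, hpow 5, hpow 6⟩
  have := hpow 1
  simpa [hA] using this

/-! ### Counting eigenvalues with Descartes' rule of signs -/

/-- The coefficients of `720 * ∏ i, (X - (x i - a))`, highest degree first, for a spectrum `x` with
the given power sums. Each coefficient is given as a difference of two natural numbers. -/
def shifted (p : PowerSums) (a : ℕ) : List (ℕ × ℕ) :=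
  [(720, 0), (4320 * a, 0), (10800 * a * a, 360 * p.p2),
   (14400 * a * a * a, 1440 * p.p2 * a + 240 * p.p3),
   (10800 * a * a * a * a + 90 * p.p2 * p.p2, (2160 * p.p2 * a + 720 * p.p3) * a + 180 * p.p4),
   (4320 * a * a * a * a * a + 180 * p.p2 * p.p2 * a + 120 * p.p2 * p.p3,
    ((1440 * p.p2 * a + 720 * p.p3) * a + 360 * p.p4) * a + 144 * p.p5),
   (((720 * a * a * a * a + 90 * p.p2 * p.p2) * a + 120 * p.p2 * p.p3) * a +
      90 * p.p2 * p.p4 + 40 * p.p3 * p.p3,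
    (((360 * p.p2 * a + 240 * p.p3) * a + 180 * p.p4) * a + 144 * p.p5) * a +
      120 * p.p6 + 15 * p.p2 * p.p2 * p.p2)]

/-- Negate every second coefficient, beginning with the second one. -/
def alternate : List (ℕ × ℕ) → List (ℕ × ℕ)
  | x :: y :: l => x :: y.swap :: alternate l
  | l => l

/-- Count the sign changes caused by the coefficient `x.1 - x.2`, where `pos` tells whether the last
nonzero coefficient was positive and `rest` counts the later sign changes. -/
def signStep (x : ℕ × ℕ) (rest : Bool → ℕ) (pos : Bool) : ℕ :=
  bif x.1.ble x.2 then
    bif x.2.ble x.1 then rest pos else bif pos then rest false + 1 else rest false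
  else bif pos then rest true else rest true + 1

/-- The number of sign changes in a list of differences which begins with a positive one. -/
def signChanges (l : List (ℕ × ℕ)) : ℕ := l.foldr signStep (fun _ => 0) true

/-- The difference represented by a pair of natural numbers. -/
def diff (x : ℕ × ℕ) : ℝ := x.1 - x.2

/-- The polynomial with the given coefficients, highest degree first. -/
noncomputable def ofCoeffs (l : List (ℕ × ℕ)) : ℝ[X] :=
  l.foldl (fun P c => P * X + C (diff c)) 0

lemma foldr_signStep (l : List (ℕ × ℕ)) (pos : Bool) :
    l.foldr signStep (fun _ => 0) pos =
      (((l.map fun x => SignType.sign (diff x)).filter (· ≠ 0)).destutter' (· ≠ ·)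
        (if pos then 1 else -1)).length - 1 := by
  induction l generalizing pos with
  | nil => simp
  | cons x l ih =>
    have hpos : ∀ s : SignType,
        ((((l.map fun x => SignType.sign (diff x)).filter (· ≠ 0)).destutter' (· ≠ ·) s).length
          - 1) + 1 =
        (((l.map fun x => SignType.sign (diff x)).filter (· ≠ 0)).destutter' (· ≠ ·) s).length :=
      fun s => Nat.sub_add_cancel (List.length_pos_iff.2 (List.destutter'_ne_nil _ _))
    rw [List.foldr_cons, List.map_cons, signStep, ih, ih, ih]
    rcases lt_trichotomy x.1 x.2 with h | h | h
    · have hs : SignType.sign (diff x) = -1 := sign_neg (by simpa [diff] using h)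
      have h1 : x.1.ble x.2 = true := by simpa using h.le
      have h2 : x.2.ble x.1 = false := by rw [← Bool.not_eq_true, Nat.ble_eq]; omega
      cases pos
      · simp [hs, h1, h2]
      · simpa [hs, h1, h2, List.destutter'_cons] using hpos (-1)
    · have hs : SignType.sign (diff x) = 0 := by simp [diff, h]
      have h1 : x.1.ble x.2 = true := by simpa using h.le
      have h2 : x.2.ble x.1 = true := by simpa using h.ge
      simp [hs, h1, h2]
    · have hs : SignType.sign (diff x) = 1 := sign_pos (by simpa [diff] using h)
      have h1 : x.1.ble x.2 = false := by rw [← Bool.not_eq_true, Nat.ble_eq]; omega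
      cases pos
      · simpa [hs, h1, List.destutter'_cons] using hpos 1
      · simp [hs, h1]

lemma coeffList_ofCoeffs_cons {c : ℕ × ℕ} (hc : diff c ≠ 0) (l : List (ℕ × ℕ)) :
    (ofCoeffs (c :: l)).coeffList = (c :: l).map diff := by
  induction l using List.reverseRecOn with
  | nil => simp [ofCoeffs, coeffList_C hc]
  | append_singleton l d ih =>
    have h1 : ofCoeffs (c :: (l ++ [d])) = ofCoeffs (c :: l) * X + C (diff d) := by
      simp [ofCoeffs, List.foldl_append]
    have h0 : ofCoeffs (c :: l) ≠ 0 := by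
      rintro h
      simp [h] at ih
    have h2 : ofCoeffs (c :: l) * X + C (diff d) ≠ 0 := by
      intro h
      exact h0 (ext fun n => by simpa [coeff_C_succ] using congrArg (fun P => P.coeff (n + 1)) h)
    have hdeg : (ofCoeffs (c :: l) * X + C (diff d)).degree.succ =
        (ofCoeffs (c :: l)).degree.succ + 1 := by
      rw [withBotSucc_degree_eq_natDegree_add_one h2, withBotSucc_degree_eq_natDegree_add_one h0,
        natDegree_add_C, natDegree_mul_X h0]
    rw [h1, coeffList, hdeg, List.range_succ_eq_map, ← List.cons_append, List.map_append, ← ih,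
      coeffList]
    simp [Function.comp_def, coeff_C_succ]

lemma signVariations_ofCoeffs {c : ℕ × ℕ} (hc : 0 < diff c) (l : List (ℕ × ℕ)) :
    (ofCoeffs (c :: l)).signVariations = signChanges (c :: l) := by
  rw [signVariations, coeffList_ofCoeffs_cons hc.ne', List.map_map]
  have h := foldr_signStep l true
  have hlt : c.2 < c.1 := by simpa [diff] using hc
  have h1 : c.1.ble c.2 = false := by rw [← Bool.not_eq_true, Nat.ble_eq]; omega
  simp [signChanges, signStep, h1, h, Function.comp_def, sign_pos hc, List.destutter_cons']

lemma foldl_shifted {R : Type*} [CommRing R] (p : PowerSums) (a : ℕ) (t : R) :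
    (shifted p a).foldl (fun P c => P * t + (c.1 - c.2)) 0 =
      720 * (t + a) ^ 6 - 360 * p.p2 * (t + a) ^ 4 - 240 * p.p3 * (t + a) ^ 3
        + (90 * p.p2 ^ 2 - 180 * p.p4) * (t + a) ^ 2
        + (120 * p.p2 * p.p3 - 144 * p.p5) * (t + a)
        + (90 * p.p2 * p.p4 + 40 * p.p3 ^ 2 - 120 * p.p6 - 15 * p.p2 ^ 3) := by
  simp only [shifted, List.foldl_cons, List.foldl_nil]
  push_cast
  ring

lemma foldl_alternate_shifted {R : Type*} [CommRing R] (p : PowerSums) (a : ℕ) (t : R) :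
    (alternate (shifted p a)).foldl (fun P c => P * t + (c.1 - c.2)) 0 =
      (shifted p a).foldl (fun P c => P * (-t) + (c.1 - c.2)) 0 := by
  simp only [shifted, alternate, Prod.swap, List.foldl_cons, List.foldl_nil]
  ring

lemma ofCoeffs_eq (l : List (ℕ × ℕ)) :
    ofCoeffs l = l.foldl (fun P c => P * X + ((c.1 : ℝ[X]) - (c.2 : ℝ[X]))) 0 := by
  simp [ofCoeffs, diff]

lemma PowerSums.Represents.prod_eq {p : PowerSums} {x : Fin 6 → ℝ} (h : p.Represents x) (t : ℝ[X])
    (a : ℕ) : 720 * ∏ i, (t - C (x i - a)) =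
      (shifted p a).foldl (fun P c => P * t + (c.1 - c.2)) 0 := by
  have hx : ∑ i, C (x i) = 0 := by rw [← map_sum, h.sum, map_zero]
  have := prod_sub_eq_of_powerSums (fun i => C (x i)) hx (t + C (a : ℝ))
  simp only [← C_pow, ← map_sum, h.sum2, h.sum3, h.sum4, h.sum5, h.sum6, map_natCast] at this
  simp only [foldl_shifted, ← this, C_sub, map_natCast, sub_sub_eq_add_sub]

lemma card_pos_le_of_prod {l : List (ℕ × ℕ)} {c : ℕ × ℕ} (hc : 0 < diff c) (y : Fin 6 → ℝ)
    (h : 720 * ∏ i, (X - C (y i)) = ofCoeffs (c :: l)) :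
    (Finset.univ.filter fun i => 0 < y i).card ≤ signChanges (c :: l) := by
  rw [← signVariations_ofCoeffs hc, ← h]
  refine le_trans (le_of_eq ?_) (roots_countP_pos_le_signVariations _)
  have h720 : (720 : ℝ[X]) = C 720 := (map_ofNat C 720).symm
  have hp : (∏ i, (X - C (y i))).roots = Finset.univ.val.map y := by
    rw [← roots_multiset_prod_X_sub_C (Finset.univ.val.map y), Multiset.map_map]
    rfl
  rw [h720, roots_C_mul _ (by norm_num), hp, Multiset.countP_map]
  rfl

lemma PowerSums.Represents.card_above_le {p : PowerSums} {x : Fin 6 → ℝ} (h : p.Represents x)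
    (a : ℕ) : (Finset.univ.filter fun i => (a : ℝ) < x i).card ≤ signChanges (shifted p a) := by
  have := card_pos_le_of_prod (c := (720, 0)) (l := (shifted p a).tail) (by simp [diff])
    (fun i => x i - a) ((h.prod_eq X a).trans (ofCoeffs_eq _).symm)
  simp only [sub_pos] at this
  exact this

lemma PowerSums.Represents.card_below_le {p : PowerSums} {x : Fin 6 → ℝ} (h : p.Represents x)
    (a : ℕ) :
    (Finset.univ.filter fun i => x i < (a : ℝ)).card ≤ signChanges (alternate (shifted p a)) := by
  have h2 : ∏ i, (X - C (a - x i)) = ∏ i, (-X - C (x i - a)) := by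
    simp only [Fin.prod_univ_six, C_sub]
    ring
  have := card_pos_le_of_prod (c := (720, 0)) (l := (alternate (shifted p a)).tail)
    (by simp [diff]) (fun i => a - x i)
    ((congrArg (720 * ·) h2).trans ((h.prod_eq (-X) a).trans
      ((foldl_alternate_shifted p a X).symm.trans (ofCoeffs_eq _).symm)))
  simp only [sub_pos] at this
  exact this

/-! ### Comparing energies -/

/-- A certificate that at most `k` eigenvalues are greater than `a`. -/
def fewAbove (p : PowerSums) (k a : ℕ) : Bool := (signChanges (shifted p a)).ble k

/-- A certificate that at most `k` eigenvalues are less than `a`. -/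
def fewBelow (p : PowerSums) (k a : ℕ) : Bool := (signChanges (alternate (shifted p a))).ble k

/-- Apply `f` to `a`, where `a` is evaluated first in kernel computations. -/
def force {α : Type} (f : ℕ → α) : ℕ → α
  | 0 => f 0
  | a + 1 => f (a + 1)

lemma force_eq {α : Type} (f : ℕ → α) (a : ℕ) : force f a = f a := by cases a <;> rfl

/-- Apply `f` to `p`, where the entries of `p` are evaluated first in kernel computations. -/
def PowerSums.force {α : Type} (f : PowerSums → α) (p : PowerSums) : α :=
  p.p2 |> GraphEnergy.force fun p2 => p.p3 |> GraphEnergy.force fun p3 =>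
    p.p4 |> GraphEnergy.force fun p4 => p.p5 |> GraphEnergy.force fun p5 =>
      p.p6 |> GraphEnergy.force fun p6 => f ⟨p2, p3, p4, p5, p6⟩

lemma PowerSums.force_eq {α : Type} (f : PowerSums → α) (p : PowerSums) : p.force f = f p := by
  simp only [PowerSums.force, GraphEnergy.force_eq]

/-- Binary search with `n` steps for the least number satisfying `good`, starting at `a`. -/
def search (good : ℕ → Bool) : ℕ → ℕ → ℕ
  | 0, a => a
  | n + 1, a =>
    (a - 2 ^ n) |> force fun b => bif good b then search good n b else search good n a

/-- An upper bound for the positive part of the `k`-th largest eigenvalue, provided that all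
eigenvalues are smaller than `2 ^ n`. -/
def upper (p : PowerSums) (n k : ℕ) : ℕ :=
  bif fewAbove p k 0 then 0 else search (fewAbove p k) n (2 ^ n - 1)

/-- A lower bound for the positive part of the `k`-th largest eigenvalue. -/
def lower (p : PowerSums) (n k : ℕ) : ℕ :=
  let a := upper p n k - 1
  bif fewBelow p (5 - k) a then a else 0

/-- A certificate that `p` belongs to a graph of smaller energy than `q`. -/
def energyLT (p q : PowerSums) (n : ℕ) : Bool :=
  fewAbove p 0 (2 ^ n - 1) &&
    ((List.range 6).map (upper p n)).sum.blt ((List.range 6).map (lower q n)).sum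

/-- A certificate that `p` and `q` belong to graphs of different energy. -/
def energyNe (p q : PowerSums) : Bool :=
  [2, 3, 5, 9].any fun n =>
    (p.scale (2 ^ n)).force fun p => (q.scale (2 ^ n)).force fun q =>
      energyLT p q (n + 3) || energyLT q p (n + 3)

lemma search_spec {good : ℕ → Bool} {a : ℕ} (h : good a = true) (n : ℕ) :
    good (search good n a) = true := by
  induction n generalizing a with
  | zero => exact h
  | succ n ih =>
    rw [search, force_eq]
    cases h' : good (a - 2 ^ n)
    · exact ih h
    · exact ih h'

namespace PowerSums.Represents

variable {p q : PowerSums} {x y : Fin 6 → ℝ}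

lemma le_of_fewAbove (h : p.Represents x) (hx : Antitone x) {k : Fin 6} {a : ℕ}
    (hk : fewAbove p k a = true) : x k ≤ a := by
  by_contra! hlt
  have h1 : Finset.Iic k ⊆ Finset.univ.filter fun i => (a : ℝ) < x i := fun i hi => by
    simpa using hlt.trans_le (hx (Finset.mem_Iic.1 hi))
  have h2 := (Finset.card_le_card h1).trans ((h.card_above_le a).trans (Nat.le_of_ble_eq_true hk))
  rw [Fin.card_Iic] at h2
  omega

lemma le_of_fewBelow (h : p.Represents x) (hx : Antitone x) {k : Fin 6} {a : ℕ}
    (hk : fewBelow p (5 - k) a = true) : a ≤ x k := by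
  by_contra! hlt
  have h1 : Finset.Ici k ⊆ Finset.univ.filter fun i => x i < (a : ℝ) := fun i hi => by
    simpa using (hx (Finset.mem_Ici.1 hi)).trans_lt hlt
  have h2 := (Finset.card_le_card h1).trans ((h.card_below_le a).trans (Nat.le_of_ble_eq_true hk))
  rw [Fin.card_Ici] at h2
  omega

lemma posPart_le_upper (h : p.Represents x) (hx : Antitone x) {n : ℕ}
    (hn : fewAbove p 0 (2 ^ n - 1) = true) (k : Fin 6) : max (x k) 0 ≤ upper p n k := by
  refine max_le (h.le_of_fewAbove hx ?_) (Nat.cast_nonneg _)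
  have hk : fewAbove p k (2 ^ n - 1) = true :=
    Nat.ble_eq_true_of_le ((Nat.le_of_ble_eq_true hn).trans (Nat.zero_le _))
  rw [upper]
  cases h0 : fewAbove p k 0
  · exact search_spec hk n
  · exact h0

lemma lower_le_posPart (h : p.Represents x) (hx : Antitone x) (n : ℕ) (k : Fin 6) :
    lower p n k ≤ max (x k) 0 := by
  rw [lower]
  cases hk : fewBelow p (5 - k) (upper p n k - 1)
  · simp
  · simpa [hk] using Or.inl (h.le_of_fewBelow hx hk)

lemma sum_abs (h : p.Represents x) : ∑ i, |x i| = 2 * ∑ i, max (x i) 0 := by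
  have (t : ℝ) : |t| = 2 * max t 0 - t := by
    rcases le_total 0 t with ht | ht
    · rw [abs_of_nonneg ht, max_eq_left ht]
      ring
    · rw [abs_of_nonpos ht, max_eq_right ht]
      ring
  simp only [this, Finset.sum_sub_distrib, h.sum, Finset.mul_sum, sub_zero]

lemma sum_abs_lt (hp : p.Represents x) (hq : q.Represents y) (hx : Antitone x) (hy : Antitone y)
    {n : ℕ} (h : energyLT p q n = true) : ∑ i, |x i| < ∑ i, |y i| := by
  have hsum (f : ℕ → ℕ) : ((List.range 6).map f).sum = ∑ i : Fin 6, f i := by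
    simp [Fin.sum_univ_six, List.range_succ, add_assoc]
  rw [energyLT, Bool.and_eq_true, Nat.blt_eq, hsum, hsum, ← Nat.cast_lt (α := ℝ)] at h
  push_cast at h
  rw [hp.sum_abs, hq.sum_abs]
  have h1 := Finset.sum_le_sum fun k (_ : k ∈ Finset.univ) => hp.posPart_le_upper hx h.1 k
  have h2 := Finset.sum_le_sum fun k (_ : k ∈ Finset.univ) => hq.lower_le_posPart hy n k
  linarith [h.2]

lemma sum_abs_ne (hp : p.Represents x) (hq : q.Represents y) (hx : Antitone x) (hy : Antitone y)
    (h : energyNe p q = true) : ∑ i, |x i| ≠ ∑ i, |y i| := by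
  obtain ⟨n, -, hn⟩ := List.any_eq_true.1 h
  simp only [PowerSums.force_eq] at hn
  have hK : (0 : ℝ) ≤ (2 ^ n : ℕ) := Nat.cast_nonneg _
  intro hxy
  have hxy : ∑ i, |(2 ^ n : ℕ) * x i| = ∑ i, |(2 ^ n : ℕ) * y i| := by
    simp only [abs_mul, ← Finset.mul_sum, hxy]
  rcases (Bool.or_eq_true _ _).mp hn with hlt | hlt
  · exact (sum_abs_lt (hp.scale _) (hq.scale _) (hx.const_mul hK) (hy.const_mul hK) hlt).ne hxy
  · exact (sum_abs_lt (hq.scale _) (hp.scale _) (hy.const_mul hK) (hx.const_mul hK) hlt).ne' hxy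

lemma map_eq (hx : p.Represents x) (hy : p.Represents y) :
    Finset.univ.val.map x = Finset.univ.val.map y := by
  have h (z : Fin 6 → ℝ) : (∏ i, (X - C (z i))).roots = Finset.univ.val.map z := by
    rw [← roots_multiset_prod_X_sub_C (Finset.univ.val.map z), Multiset.map_map]
    rfl
  have h720 : (720 : ℝ[X]) ≠ 0 := by norm_num
  have hprod := (hx.prod_eq X 0).trans (hy.prod_eq X 0).symm
  simp only [Nat.cast_zero, sub_zero] at hprod
  rw [← h, ← h, mul_left_cancel₀ h720 hprod]

lemma sum_abs_eq (hx : p.Represents x) (hy : p.Represents y) : ∑ i, |x i| = ∑ i, |y i| := by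
  have := congrArg (fun s => (s.map abs).sum) (hx.map_eq hy)
  simp only [Multiset.map_map] at this
  exact this

end PowerSums.Represents

/-! ### Graphs and their complements -/

lemma energy_eq_of_iso {V W : Type*} [Finite V] [Finite W] {G : SimpleGraph V}
    {H : SimpleGraph W} (φ : G ≃g H) : energy G = energy H := by
  let := Fintype.ofFinite V
  let := Fintype.ofFinite W
  classical
  have h : adjMat H = (adjMat G).reindex φ.toEquiv φ.toEquiv := by
    ext i j
    have : G.Adj (φ.symm i) (φ.symm j) ↔ H.Adj i j := φ.symm.map_adj_iff
    by_cases hij : H.Adj i j <;> simp_all [adjMat, SimpleGraph.adjMatrix_apply] <;> exact this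
  have hch : (adjMat H).charpoly = (adjMat G).charpoly := by rw [h, Matrix.charpoly_reindex]
  unfold energy
  convert congrArg (fun P : ℝ[X] => (P.roots.map fun x => |x|).sum) hch.symm

/-- An isomorphism of graphs is an isomorphism of their complements. -/
def complIso {V W : Type*} {G : SimpleGraph V} {H : SimpleGraph W} (φ : G ≃g H) : Gᶜ ≃g Hᶜ :=
  ⟨φ.toEquiv, by simp [SimpleGraph.compl_adj, φ.map_adj_iff]⟩

lemma energy_maskGraph_eq {m : ℕ} {y : Fin 6 → ℝ} (hy : (maskMatrix m).powerSums.Represents y) :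
    energy (maskGraph m) = ∑ i, |y i| := by
  obtain ⟨x, -, he, hx⟩ := exists_eigenvalues (maskGraph m)
  rw [he, (represents_of_maskGraph hx).sum_abs_eq hy]

lemma energy_maskGraph_ne {m n : ℕ}
    (h : energyNe (maskMatrix m).powerSums (maskMatrix n).powerSums = true) :
    energy (maskGraph m) ≠ energy (maskGraph n) := by
  obtain ⟨x, hx, hex, htx⟩ := exists_eigenvalues (maskGraph m)
  obtain ⟨y, hy, hey, hty⟩ := exists_eigenvalues (maskGraph n)
  rw [hex, hey]
  exact (represents_of_maskGraph htx).sum_abs_ne (represents_of_maskGraph hty) hx hy h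

set_option maxRecDepth 10000 in
lemma forallMinimal_energyNe : forallMinimal (fun m => !complMinimal m || m.beq 3440 ||
    energyNe (maskMatrix m).powerSums (maskMatrix (32767 - m)).powerSums) 14 0 = true := by
  decide +kernel

lemma compl_cycle : (maskGraph 3440)ᶜ = maskGraph 29327 := compl_maskGraph (by norm_num)

lemma energy_cycle : energy (maskGraph 3440) = 8 := by
  have hp : (maskMatrix 3440).powerSums = ⟨12, 0, 36, 0, 132⟩ := rfl
  rw [energy_maskGraph_eq (y := ![2, 1, 1, -1, -1, -2])]
  · norm_num [Fin.sum_univ_succ]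
  · rw [hp]
    constructor <;> norm_num [Fin.sum_univ_succ]

lemma energy_prism : energy (maskGraph 29327) = 8 := by
  have hp : (maskMatrix 29327).powerSums = ⟨18, 12, 114, 180, 858⟩ := rfl
  rw [energy_maskGraph_eq (y := ![3, 1, 0, 0, -2, -2])]
  · norm_num [Fin.sum_univ_succ]
  · rw [hp]
    constructor <;> norm_num [Fin.sum_univ_succ]

lemma not_nonempty_iso_compl_cycle : ¬ Nonempty (maskGraph 3440 ≃g (maskGraph 3440)ᶜ) := by
  rintro ⟨φ⟩
  rw [compl_cycle] at φ
  have h1 : (maskGraph 3440).edgeFinset.card = 6 := by decide +kernel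
  have h2 : (maskGraph 29327).edgeFinset.card = 9 := by decide +kernel
  have := φ.card_edgeFinset_eq
  omega

/-- Up to isomorphism and complementation, the hexagon is the only graph which has the same energy
as its complement. -/
lemma nonempty_iso_cycle_of_energy_eq {G : SimpleGraph (Fin 6)} (hG : energy G = energy Gᶜ) :
    Nonempty (G ≃g maskGraph 3440) ∨ Nonempty (Gᶜ ≃g maskGraph 3440) := by
  obtain ⟨m, hm, hiso, hmin, hcompl⟩ := exists_minimal_mask G
  have hm0 : m / 2 ^ 14 = 0 := Nat.div_eq_of_lt hm
  have h := forallMinimal_spec hmin (n := 14) (by rw [hm0]; exact forallMinimal_energyNe)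
  have hE : energy (maskGraph m) = energy (maskGraph (32767 - m)) := by
    rw [← compl_maskGraph (by omega)]
    rcases hiso with ⟨⟨φ⟩⟩ | ⟨⟨φ⟩⟩
    · rw [← energy_eq_of_iso φ, ← energy_eq_of_iso (complIso φ), hG]
    · rw [← energy_eq_of_iso φ, ← energy_eq_of_iso (complIso φ), compl_compl, hG]
  have hne := mt energy_maskGraph_ne (not_not_intro hE)
  simp only [hcompl, hne, Bool.not_true, Bool.false_or, Bool.or_false,
    Nat.beq_eq] at h
  rwa [h] at hiso

end GraphEnergy

/-- There is exactly one pair of complementary equienergetic graphs of order 6: there is a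
6-vertex graph `D`, not isomorphic to its complement and equienergetic with its complement,
such that every 6-vertex graph `G` not isomorphic to `Gᶜ` with `E(G) = E(Gᶜ)` is isomorphic
to `D` or to `Dᶜ`. -/
theorem unique_complementary_equienergetic_pair_order_six :
    ∃ D : SimpleGraph (Fin 6),
      ¬ Nonempty (D ≃g Dᶜ) ∧ energy D = energy Dᶜ ∧
      ∀ G : SimpleGraph (Fin 6), ¬ Nonempty (G ≃g Gᶜ) → energy G = energy Gᶜ →
        Nonempty (G ≃g D) ∨ Nonempty (G ≃g Dᶜ) := by
  refine ⟨GraphEnergy.maskGraph 3440, GraphEnergy.not_nonempty_iso_compl_cycle, ?_,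
    fun G _ hG => ?_⟩
  · rw [GraphEnergy.compl_cycle, GraphEnergy.energy_cycle, GraphEnergy.energy_prism]
  · rcases GraphEnergy.nonempty_iso_cycle_of_energy_eq hG with h | ⟨⟨φ⟩⟩
    · exact .inl h
    · have ψ := GraphEnergy.complIso φ
      rw [compl_compl] at ψ
      exact .inr ⟨ψ⟩
end
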